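/- arXiv:1806.02838 — 2 statements merged into one kernel-verified Lean document; each statement's English description precedes it below -/
import Mathlib

section
/- For every integer p ≥ 2 and all n, ex(n, L_3(θ_{3,p})) ≤ 12^4 · p^6 · n^{7/5}. -/
open SimpleGraph

/-- `G` contains a copy of `H` (an injective graph homomorphism from `H` to `G`). -/
def SimpleGraph.Contains {α β : Type*} (G : SimpleGraph α) (H : SimpleGraph β) : Prop :=
  ∃ f : H →g G, Function.Injective f

/-- The Turán number `ex(n, H)`: the maximum number of edges in an `n`-vertex
graph containing no copy of `H`. -/
noncomputable def exNum {β : Type*} (n : ℕ) (H : SimpleGraph β) : ℕ :=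
  sSup {N : ℕ | ∃ G : SimpleGraph (Fin n), ¬ G.Contains H ∧ G.edgeSet.ncard = N}

/-- The theta graph `θ_{3,p}`: `p` internally disjoint paths of length `3` joining the two
endpoints `Sum.inl false` and `Sum.inl true`; the `i`-th path is
`inl false — (i,0) — (i,1) — inl true`. -/
def theta3 (p : ℕ) : SimpleGraph (Bool ⊕ (Fin p × Fin 2)) :=
  SimpleGraph.fromRel fun x y =>
    match x, y with
    | Sum.inl b, Sum.inr (_, j) => (b = false ∧ (j : ℕ) = 0) ∨ (b = true ∧ (j : ℕ) = 1)
    | Sum.inr (i, j), Sum.inr (ii, jj) => i = ii ∧ (jj : ℕ) = (j : ℕ) + 1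
    | _, _ => False

/-- The partite set `A` of `θ_{3,p}` containing `inl false`, enumerated by `Fin (p+1)`:
it consists of `inl false` together with the internal vertices `(i, 1)`. -/
def AvertOf (p : ℕ) : Fin (p + 1) → Bool ⊕ (Fin p × Fin 2) :=
  Fin.cases (Sum.inl false) fun i => Sum.inr (i, 1)

/-- `L₃(θ_{3,p})`: the graph obtained from `θ_{3,p}` by adding a new vertex (`inr (inr ())`)
joined to every vertex of the partite set `A` by internally disjoint paths of length `2`,
whose internal vertices (`inr (inl j)` for `j : Fin (p+1)`) are new and distinct. -/
def L3theta3 (p : ℕ) :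
    SimpleGraph ((Bool ⊕ (Fin p × Fin 2)) ⊕ (Fin (p + 1) ⊕ Unit)) :=
  SimpleGraph.fromRel fun x y =>
    match x, y with
    | Sum.inl a, Sum.inl b => (theta3 p).Adj a b
    | Sum.inr (Sum.inl _), Sum.inr (Sum.inr _) => True
    | Sum.inl a, Sum.inr (Sum.inl j) => a = AvertOf p j
    | _, _ => False

open scoped Classical in
/-- The common neighbours of `x` and `y`. -/
noncomputable def coNbr {V : Type*} [Fintype V] (G : SimpleGraph V) (x y : V) : Finset V :=
  Finset.univ.filter fun v => G.Adj x v ∧ G.Adj y v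

/-- Distinct vertices with at least `L` common neighbours. -/
def HeavyPair {V : Type*} [Fintype V] (G : SimpleGraph V) (L : ℕ) (x y : V) : Prop :=
  x ≠ y ∧ L ≤ (coNbr G x y).card

/-- Distinct vertices with fewer than `L` common neighbours. -/
def LightPair {V : Type*} [Fintype V] (G : SimpleGraph V) (L : ℕ) (x y : V) : Prop :=
  x ≠ y ∧ (coNbr G x y).card < L

section Basic

variable {V : Type*} [Fintype V] {G : SimpleGraph V}

theorem mem_coNbr {x y v : V} : v ∈ coNbr G x y ↔ G.Adj x v ∧ G.Adj y v := by
  simp [coNbr]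

theorem lightPair_iff {L : ℕ} {x y : V} : LightPair G L x y ↔ x ≠ y ∧ ¬ HeavyPair G L x y := by
  unfold LightPair HeavyPair
  constructor
  · rintro ⟨h1, h2⟩
    exact ⟨h1, fun h => by omega⟩
  · rintro ⟨h1, h2⟩
    exact ⟨h1, by by_contra h; exact h2 ⟨h1, by omega⟩⟩

end Basic

/-- An explicit configuration of vertices forming `L₃(θ_{3,p})`. -/
theorem contains_of_configuration {V : Type*} {G : SimpleGraph V} {p : ℕ}
    (u a z w₀ : V) (b c w : Fin p → V)
    (hua : u ≠ a) (huz : u ≠ z) (haz : a ≠ z) (hzw₀ : z ≠ w₀)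
    (huw₀ : G.Adj u w₀) (haw₀ : G.Adj a w₀)
    (hab : ∀ i, G.Adj a (b i)) (hbc : ∀ i, G.Adj (b i) (c i)) (hcz : ∀ i, G.Adj (c i) z)
    (hcw : ∀ i, G.Adj (c i) (w i)) (huw : ∀ i, G.Adj u (w i))
    (hbw : ∀ i, b i ≠ w i)
    (hfix : ∀ i, ∀ x, (x = c i ∨ x = b i ∨ x = w i) → x ≠ u ∧ x ≠ a ∧ x ≠ z ∧ x ≠ w₀)
    (hdisj : ∀ i j, i ≠ j → ∀ x, (x = c i ∨ x = b i ∨ x = w i) →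
      ¬ (x = c j ∨ x = b j ∨ x = w j)) :
    G.Contains (L3theta3 p) := by
  let f : (Bool ⊕ (Fin p × Fin 2)) ⊕ (Fin (p + 1) ⊕ Unit) → V := fun x =>
    match x with
    | Sum.inl (Sum.inl false) => a
    | Sum.inl (Sum.inl true) => z
    | Sum.inl (Sum.inr (i, 0)) => b i
    | Sum.inl (Sum.inr (i, 1)) => c i
    | Sum.inr (Sum.inl j) => Fin.cases w₀ w j
    | Sum.inr (Sum.inr ()) => u
  have htheta : ∀ x y, (theta3 p).Adj x y → G.Adj (f (Sum.inl x)) (f (Sum.inl y)) := by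
    intro x y h
    rw [theta3, SimpleGraph.fromRel_adj] at h
    obtain ⟨hne, h⟩ := h
    rcases x with (_ | _) | ⟨i, j⟩ <;> rcases y with (_ | _) | ⟨i', j'⟩ <;>
      (try fin_cases j) <;> (try fin_cases j') <;> simp [f] at h ⊢
    all_goals first
      | exact hab _
      | exact (hab _).symm
      | exact hcz _
      | exact (hcz _).symm
      | (subst h; exact hbc _)
      | (subst h; exact (hbc _).symm)
  have hA : ∀ j, G.Adj (f (Sum.inl (AvertOf p j))) (f (Sum.inr (Sum.inl j))) := by
    intro j
    refine Fin.cases ?_ (fun i => ?_) j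
    · exact haw₀
    · exact hcw i
  have hU : ∀ j, G.Adj (f (Sum.inr (Sum.inl j))) u := by
    intro j
    refine Fin.cases ?_ (fun i => ?_) j
    · exact huw₀.symm
    · exact (huw i).symm
  have hrel : ∀ x y, (L3theta3 p).Adj x y → G.Adj (f x) (f y) := by
    intro x y h
    rw [L3theta3, SimpleGraph.fromRel_adj] at h
    obtain ⟨hne, h⟩ := h
    rcases x with x | (j | ⟨⟩) <;> rcases y with y | (j' | ⟨⟩) <;> simp only [or_false, false_or] at h
    · rcases h with h | h
      · exact htheta _ _ h
      · exact (htheta _ _ h).symm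
    · subst h; exact hA _
    · subst h; exact (hA _).symm
    · exact hU _
    · exact (hU _).symm
  refine ⟨⟨f, fun {x y} h => hrel x y h⟩, ?_⟩
  intro x y hxy
  change f x = f y at hxy
  have hbi := fun i => hfix i (b i) (by simp)
  have hci := fun i => hfix i (c i) (by simp)
  have hwi := fun i => hfix i (w i) (by simp)
  have hbc' := fun i => (hbc i).ne
  have hcw' := fun i => (hcw i).ne
  have hbd := fun i j h => hdisj i j h (b i) (by simp)
  have hcd := fun i j h => hdisj i j h (c i) (by simp)
  have hwd := fun i j h => hdisj i j h (w i) (by simp)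
  have hu0 := huw₀.ne
  have ha0 := haw₀.ne
  clear hfix hdisj hrel hU hA htheta
  rcases x with ((_ | _) | ⟨i, j⟩) | (i | ⟨⟩) <;> rcases y with ((_ | _) | ⟨i', j'⟩) | (i' | ⟨⟩) <;>
    (try fin_cases j) <;> (try fin_cases j') <;>
    (try induction i using Fin.cases) <;> (try induction i' using Fin.cases) <;>
    simp [f] at hxy ⊢ <;> grind

/-- In a relation on `T` without a book of `p` triangles, at least half of
the points are unrelated to almost half of the points. -/
theorem card_le_two_mul_card_sparse {V : Type*} [DecidableEq V] (R : V → V → Prop) [DecidableRel R]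
    (p : ℕ) (T : Finset V)
    (hbook : ∀ x ∈ T, ∀ y ∈ T, R x y → (T.filter fun c => R x c ∧ R y c).card < p) :
    T.card ≤ 2 * (T.filter fun x =>
      T.card ≤ 2 * (T.filter fun y => x ≠ y ∧ ¬ R x y).card + p + 2).card := by
  classical
  have hsplit : ∀ x ∈ T, T.card ≤ (T.filter fun y => R x y).card +
      (T.filter fun y => x ≠ y ∧ ¬ R x y).card + 1 := by
    intro x hx
    have : T ⊆ (T.filter fun y => R x y) ∪ (T.filter fun y => x ≠ y ∧ ¬ R x y) ∪ {x} := by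
      intro y hy
      simp only [Finset.mem_union, Finset.mem_filter, Finset.mem_singleton]
      by_cases h1 : R x y
      · simp [hy, h1]
      · by_cases h2 : x = y
        · simp [h2]
        · simp [hy, h1, h2]
    calc T.card ≤ _ := Finset.card_le_card this
      _ ≤ _ := Finset.card_union_le _ _
      _ ≤ _ := by gcongr; exacts [Finset.card_union_le _ _, by simp]
  set P : V → Prop := fun x => T.card ≤ 2 * (T.filter fun y => x ≠ y ∧ ¬ R x y).card + p + 2 with hP
  have hbad : ∀ x ∈ T, ¬ P x → T.card + p ≤ 2 * (T.filter fun y => R x y).card := by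
    intro x hx hPx
    have := hsplit x hx
    simp only [hP] at hPx
    omega
  have hpart := Finset.card_filter_add_card_filter_not (s := T) P
  by_contra hcon
  change ¬ T.card ≤ 2 * (T.filter P).card at hcon
  have hB : T.card < 2 * (T.filter fun x => ¬ P x).card := by omega
  have hne : (T.filter fun x => ¬ P x).Nonempty := by
    rw [← Finset.card_pos]; omega
  obtain ⟨x, hx⟩ := hne
  obtain ⟨hxT, hxP⟩ := Finset.mem_filter.1 hx
  have hind : ∀ y ∈ T, ¬ P y → ¬ R x y := by
    intro y hy hyP hxy
    have h1 := hbad x hxT hxP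
    have h2 := hbad y hy hyP
    have h3 := Finset.card_union_add_card_inter (T.filter fun c => R x c) (T.filter fun c => R y c)
    have h4 : ((T.filter fun c => R x c) ∪ (T.filter fun c => R y c)).card ≤ T.card :=
      Finset.card_le_card (Finset.union_subset (Finset.filter_subset _ _) (Finset.filter_subset _ _))
    rw [← Finset.filter_and] at h3
    have h5 := hbook x hxT y hy hxy
    omega
  have hsub : (T.filter fun y => R x y) ⊆ T.filter P := by
    intro y hy
    obtain ⟨hyT, hxy⟩ := Finset.mem_filter.1 hy
    refine Finset.mem_filter.2 ⟨hyT, ?_⟩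
    by_contra h
    exact hind y hyT h hxy
  have := Finset.card_le_card hsub
  have := hbad x hxT hxP
  omega

/-- A family of points with attached small sets of bounded multiplicity has many members with
pairwise disjoint sets, all disjoint from a given set. -/
theorem exists_disjoint_selection {V : Type*} [DecidableEq V] (C : Finset V) (F : V → Finset V)
    (M m : ℕ) (hF : ∀ c ∈ C, (F c).card ≤ m)
    (hM : ∀ v, (C.filter fun c => v ∈ F c).card ≤ M) (k : ℕ) :
    ∀ R : Finset V, (m * k + R.card) * M < C.card →
      ∃ f : Fin k → V, (∀ i, f i ∈ C) ∧ (∀ i, Disjoint (F (f i)) R) ∧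
        ∀ i j, i ≠ j → Disjoint (F (f i)) (F (f j)) := by
  induction k with
  | zero => intro R _; exact ⟨Fin.elim0, fun i => i.elim0, fun i => i.elim0, fun i => i.elim0⟩
  | succ k ih =>
    intro R hR
    have hex : ∃ c ∈ C, Disjoint (F c) R := by
      by_contra hcon
      push Not at hcon
      have hsub : C ⊆ R.biUnion fun v => C.filter fun c => v ∈ F c := by
        intro c hc
        obtain ⟨v, hv1, hv2⟩ := Finset.not_disjoint_iff.1 (hcon c hc)
        exact Finset.mem_biUnion.2 ⟨v, hv2, Finset.mem_filter.2 ⟨hc, hv1⟩⟩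
      have h1 := Finset.card_le_card hsub
      have h2 := Finset.card_biUnion_le_card_mul R (fun v => C.filter fun c => v ∈ F c) M
        (fun v _ => hM v)
      nlinarith [Nat.zero_le (m * (k + 1) * M)]
    obtain ⟨c, hc, hcR⟩ := hex
    have hle : (m * k + (R ∪ F c).card) * M < C.card := by
      refine lt_of_le_of_lt (Nat.mul_le_mul_right _ ?_) hR
      have := Finset.card_union_le R (F c)
      have := hF c hc
      rw [Nat.mul_succ]
      omega
    obtain ⟨f, hf1, hf2, hf3⟩ := ih (R ∪ F c) hle
    refine ⟨Fin.cons c f, ?_, ?_, ?_⟩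
    · intro i
      refine Fin.cases ?_ (fun i => ?_) i
      · simpa using hc
      · simpa using hf1 i
    · intro i
      refine Fin.cases ?_ (fun i => ?_) i
      · simpa using hcR
      · simpa using (Finset.disjoint_union_right.1 (hf2 i)).1
    · intro i j
      refine Fin.cases ?_ (fun i => ?_) i <;> refine Fin.cases ?_ (fun j => ?_) j
      · simp
      · intro _; simpa using (Finset.disjoint_union_right.1 (hf2 j)).2.symm
      · intro _; simpa using (Finset.disjoint_union_right.1 (hf2 i)).2
      · intro h; simpa using hf3 i j (fun e => h (by rw [e]))

/-- A vertex whose neighbourhood contains a book of `p` triangles of heavy pairs yields a copy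
of `L₃(θ_{3,p})`. -/
theorem contains_of_heavy_book {V : Type*} [Fintype V] {G : SimpleGraph V} {p : ℕ}
    (q u a : V) (c : Fin p → V) (hc : Function.Injective c)
    (hqu : G.Adj q u) (hqa : G.Adj q a) (hqc : ∀ i, G.Adj q (c i))
    (hua : HeavyPair G (3 * p + 4) u a) (huc : ∀ i, HeavyPair G (3 * p + 4) u (c i))
    (hac : ∀ i, HeavyPair G (3 * p + 4) a (c i)) :
    G.Contains (L3theta3 p) := by
  classical
  let F : Finset V := {q, u, a} ∪ Finset.univ.image c
  have hFcard : F.card ≤ p + 3 := by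
    have h1 : (Finset.univ.image c).card ≤ p := by
      simpa using Finset.card_image_le (s := (Finset.univ : Finset (Fin p))) (f := c)
    have h2 : ({q, u, a} : Finset V).card ≤ 3 := Finset.card_le_three
    have := Finset.card_union_le ({q, u, a} : Finset V) (Finset.univ.image c)
    simp only [F]
    omega
  let T : Fin p ⊕ Fin p ⊕ Unit → Finset V := fun j =>
    (match j with
      | Sum.inl i => coNbr G a (c i)
      | Sum.inr (Sum.inl i) => coNbr G u (c i)
      | Sum.inr (Sum.inr _) => coNbr G u a) \ F
  have hT : ∀ j, 2 * p + 1 ≤ (T j).card := by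
    intro j
    rcases j with i | i | _
    · have := Finset.le_card_sdiff F (coNbr G a (c i))
      have := (hac i).2
      simp only [T]; omega
    · have := Finset.le_card_sdiff F (coNbr G u (c i))
      have := (huc i).2
      simp only [T]; omega
    · have := Finset.le_card_sdiff F (coNbr G u a)
      have := hua.2
      simp only [T]; omega
  obtain ⟨g, hg, hgT⟩ : ∃ g : Fin p ⊕ Fin p ⊕ Unit → V, Function.Injective g ∧ ∀ j, g j ∈ T j := by
    rw [← Finset.all_card_le_biUnion_card_iff_exists_injective]
    intro s
    rcases s.eq_empty_or_nonempty with rfl | ⟨j, hj⟩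
    · simp
    · have h1 : s.card ≤ 2 * p + 1 := by
        have := Finset.card_le_univ s
        simp at this
        omega
      exact h1.trans ((hT j).trans (Finset.card_le_card (Finset.subset_biUnion_of_mem T hj)))
  have hb : ∀ i, G.Adj a (g (Sum.inl i)) ∧ G.Adj (c i) (g (Sum.inl i)) := fun i =>
    mem_coNbr.1 (Finset.mem_sdiff.1 (hgT (Sum.inl i))).1
  have hw : ∀ i, G.Adj u (g (Sum.inr (Sum.inl i))) ∧ G.Adj (c i) (g (Sum.inr (Sum.inl i))) :=
    fun i => mem_coNbr.1 (Finset.mem_sdiff.1 (hgT (Sum.inr (Sum.inl i)))).1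
  have hw₀ : G.Adj u (g (Sum.inr (Sum.inr ()))) ∧ G.Adj a (g (Sum.inr (Sum.inr ()))) :=
    mem_coNbr.1 (Finset.mem_sdiff.1 (hgT (Sum.inr (Sum.inr ())))).1
  have hgF : ∀ j, g j ≠ q ∧ g j ≠ u ∧ g j ≠ a ∧ ∀ i, g j ≠ c i := by
    intro j
    have h : g j ∉ F := (Finset.mem_sdiff.1 (hgT j)).2
    simp only [F, Finset.mem_union, Finset.mem_insert, Finset.mem_singleton, Finset.mem_image,
      Finset.mem_univ, true_and, not_or, not_exists] at h
    exact ⟨h.1.1, h.1.2.1, h.1.2.2, fun i e => h.2 i e.symm⟩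
  refine contains_of_configuration u a q (g (Sum.inr (Sum.inr ()))) (fun i => g (Sum.inl i)) c
    (fun i => g (Sum.inr (Sum.inl i))) hua.1 hqu.ne' hqa.ne' (hgF _).1.symm hw₀.1 hw₀.2
    (fun i => (hb i).1) (fun i => (hb i).2.symm) (fun i => (hqc i).symm) (fun i => (hw i).2)
    (fun i => (hw i).1) (fun i h => by simpa using hg h) ?_ ?_
  · rintro i x (rfl | rfl | rfl)
    · exact ⟨(huc i).1.symm, (hac i).1.symm, (hqc i).ne', ((hgF _).2.2.2 i).symm⟩
    · exact ⟨(hgF _).2.1, (hgF _).2.2.1, (hgF _).1, fun h => by simpa using hg h⟩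
    · exact ⟨(hgF _).2.1, (hgF _).2.2.1, (hgF _).1, fun h => by simpa using hg h⟩
  · rintro i j hij x (rfl | rfl | rfl) (h | h | h)
    · exact hij (hc h)
    · exact (hgF _).2.2.2 i h.symm
    · exact (hgF _).2.2.2 i h.symm
    · exact (hgF _).2.2.2 j h
    · exact hij (by simpa using hg h)
    · simpa using hg h
    · exact (hgF _).2.2.2 j h
    · simpa using hg h
    · exact hij (by simpa using hg h)

section Light

open scoped Classical

variable {V : Type*} [Fintype V] {G : SimpleGraph V} {p : ℕ}

/-- In an `L₃(θ_{3,p})`-free graph, at least half of the vertices of a set of neighbours of `q`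
form light pairs with almost half of that set. -/
theorem card_le_two_mul_card_mostly_light (hfree : ¬ G.Contains (L3theta3 p)) (q : V)
    (T : Finset V) (hT : ∀ x ∈ T, G.Adj q x) :
    T.card ≤ 2 * (T.filter fun x =>
      T.card ≤ 2 * (T.filter fun y => LightPair G (3 * p + 4) x y).card + p + 2).card := by
  simp only [lightPair_iff]
  refine card_le_two_mul_card_sparse (HeavyPair G (3 * p + 4)) p T ?_
  intro x hx y hy hxy
  by_contra hcon
  push Not at hcon
  set S := T.filter fun c => HeavyPair G (3 * p + 4) x c ∧ HeavyPair G (3 * p + 4) y c with hS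
  have hmem : ∀ i : Fin p, ((S.equivFin.symm (Fin.castLE hcon i) : S) : V) ∈ S := fun i =>
    Subtype.property _
  simp only [hS, Finset.mem_filter] at hmem
  refine hfree (contains_of_heavy_book q x y
    (fun i => ((S.equivFin.symm (Fin.castLE hcon i) : S) : V)) ?_ (hT x hx) (hT y hy)
    (fun i => hT _ (hmem i).1) hxy (fun i => (hmem i).2.1) (fun i => (hmem i).2.2))
  intro i j hij
  simpa using hij

/-- The number of ordered light pairs in a set of neighbours of `q`. -/
theorem sq_card_le_sum_light (hfree : ¬ G.Contains (L3theta3 p)) (q : V)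
    (T : Finset V) (hT : ∀ x ∈ T, G.Adj q x) :
    T.card * T.card ≤
      4 * (∑ x ∈ T, (T.filter fun y => LightPair G (3 * p + 4) x y).card) + (p + 2) * T.card := by
  have h := card_le_two_mul_card_mostly_light hfree q T hT
  set g : V → ℕ := fun x => (T.filter fun y => LightPair G (3 * p + 4) x y).card
  set A := T.filter fun x => T.card ≤ 2 * g x + p + 2
  have h1 : A.card * (T.card - (p + 2)) ≤ 2 * ∑ x ∈ T, g x := by
    calc A.card * (T.card - (p + 2)) ≤ ∑ x ∈ A, 2 * g x := by
          rw [← smul_eq_mul]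
          refine Finset.card_nsmul_le_sum _ _ _ fun x hx => ?_
          have := (Finset.mem_filter.1 hx).2
          omega
      _ ≤ ∑ x ∈ T, 2 * g x := Finset.sum_le_sum_of_subset (Finset.filter_subset _ _)
      _ = _ := by rw [Finset.mul_sum]
  have h2 : T.card * T.card ≤ T.card * (T.card - (p + 2)) + (p + 2) * T.card := by
    rw [mul_comm (p + 2), ← Nat.mul_add]
    exact Nat.mul_le_mul_left _ (by omega)
  have h3 : T.card * (T.card - (p + 2)) ≤ 2 * A.card * (T.card - (p + 2)) :=
    Nat.mul_le_mul_right _ h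
  rw [mul_assoc] at h3
  change _ ≤ 4 * (∑ x ∈ T, g x) + _
  omega

end Light

section Counting

open scoped Classical

variable {V : Type*} [Fintype V] {G : SimpleGraph V} {p : ℕ}

/-- A root `u` with many vertices `c` at distance two, each with a parent `π c`, such that the pairs
`u, c` are light and every parent has at most `t` children. -/
theorem exists_root [Nonempty V] (hfree : ¬ G.Contains (L3theta3 p)) (t : ℕ) (ht : p + 2 ≤ 2 * t)
    (hdeg : ∀ v, 4 * t ≤ (Finset.univ.filter fun y => G.Adj v y).card) :
    ∃ (u : V) (X : Finset V) (π : V → V),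
      (∀ c ∈ X, LightPair G (3 * p + 4) u c ∧ G.Adj u (π c) ∧ G.Adj c (π c)) ∧
      (∀ w, (X.filter fun c => π c = w).card ≤ t) ∧
      2 * (t * t) ≤ (3 * p + 4) * X.card := by
  let N : V → Finset V := fun v => Finset.univ.filter fun y => G.Adj v y
  let P : V → V → Prop := fun u w => G.Adj w u ∧
    (N w).card ≤ 2 * ((N w).filter fun y => LightPair G (3 * p + 4) u y).card + p + 2
  obtain ⟨u, hu⟩ : ∃ u, (N u).card ≤ 2 * (Finset.univ.filter fun w => P u w).card := by
    by_contra hcon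
    push Not at hcon
    have h1 : ∑ u, 2 * (Finset.univ.filter fun w => P u w).card < ∑ u, (N u).card :=
      Finset.sum_lt_sum_of_nonempty Finset.univ_nonempty fun u _ => hcon u
    have h2 : ∑ u, (Finset.univ.filter fun w => P u w).card =
        ∑ w, (Finset.univ.filter fun u => P u w).card :=
      Finset.sum_card_bipartiteAbove_eq_sum_card_bipartiteBelow P
    have h3 : ∑ w, (N w).card ≤ ∑ w, 2 * (Finset.univ.filter fun u => P u w).card := by
      refine Finset.sum_le_sum fun w _ => ?_
      have := card_le_two_mul_card_mostly_light hfree w (N w) (fun x hx => by simpa [N] using hx)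
      rw [Finset.filter_filter] at this
      exact this
    rw [← Finset.mul_sum] at h1 h3
    omega
  set W := Finset.univ.filter fun w => P u w with hW
  have hS : ∀ w, ∃ S : Finset V, w ∈ W →
      S ⊆ ((N w).filter fun y => LightPair G (3 * p + 4) u y) ∧ S.card = t := by
    intro w
    by_cases hw : w ∈ W
    · have h1 := ((Finset.mem_filter.1 hw).2).2
      have h2 := hdeg w
      change 4 * t ≤ (N w).card at h2
      obtain ⟨S, hS⟩ := Finset.exists_subset_card_eq
        (s := (N w).filter fun y => LightPair G (3 * p + 4) u y) (n := t) (by omega)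
      exact ⟨S, fun _ => hS⟩
    · exact ⟨∅, fun h => absurd h hw⟩
  choose S hS using hS
  have hSmem : ∀ w ∈ W, ∀ c ∈ S w, G.Adj w c ∧ LightPair G (3 * p + 4) u c ∧ G.Adj u w := by
    intro w hw c hc
    have h1 := Finset.mem_filter.1 ((hS w hw).1 hc)
    exact ⟨by simpa [N] using h1.1, h1.2, ((Finset.mem_filter.1 hw).2).1.symm⟩
  have hπ : ∀ c, ∃ w, c ∈ W.biUnion S → w ∈ W ∧ c ∈ S w := by
    intro c
    by_cases hc : c ∈ W.biUnion S
    · obtain ⟨w, hw⟩ := Finset.mem_biUnion.1 hc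
      exact ⟨w, fun _ => hw⟩
    · exact ⟨c, fun h => absurd h hc⟩
  choose π hπ using hπ
  refine ⟨u, W.biUnion S, π, ?_, ?_, ?_⟩
  · intro c hc
    obtain ⟨h1, h2⟩ := hπ c hc
    obtain ⟨h3, h4, h5⟩ := hSmem _ h1 c h2
    exact ⟨h4, h5, h3.symm⟩
  · intro w
    by_cases hw : w ∈ W
    · rw [← (hS w hw).2]
      refine Finset.card_le_card fun c hc => ?_
      obtain ⟨h1, rfl⟩ := Finset.mem_filter.1 hc
      exact (hπ c h1).2
    · rw [Finset.filter_eq_empty_iff.2]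
      · simp
      · rintro c hc rfl
        exact hw (hπ c hc).1
  · have h1 : ∑ w ∈ W, (S w).card = W.card * t := Finset.sum_const_nat fun w hw => (hS w hw).2
    have h2 : ∑ w ∈ W, ((W.biUnion S).filter fun c => c ∈ S w).card =
        ∑ c ∈ W.biUnion S, (W.filter fun w => c ∈ S w).card :=
      Finset.sum_card_bipartiteAbove_eq_sum_card_bipartiteBelow fun w c => c ∈ S w
    have h3 : ∑ w ∈ W, (S w).card ≤ ∑ w ∈ W, ((W.biUnion S).filter fun c => c ∈ S w).card :=
      Finset.sum_le_sum fun w hw => Finset.card_le_card fun c hc =>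
        Finset.mem_filter.2 ⟨Finset.mem_biUnion.2 ⟨w, hw, hc⟩, hc⟩
    have h4 : ∑ c ∈ W.biUnion S, (W.filter fun w => c ∈ S w).card ≤
        (W.biUnion S).card * (3 * p + 4) := by
      rw [← smul_eq_mul]
      refine Finset.sum_le_card_nsmul _ _ _ fun c hc => ?_
      obtain ⟨w, hw, hcw⟩ := Finset.mem_biUnion.1 hc
      refine le_trans (Finset.card_le_card fun w' hw' => ?_) (hSmem w hw c hcw).2.1.2.le
      obtain ⟨h5, h6⟩ := Finset.mem_filter.1 hw'
      have := hSmem w' h5 c h6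
      exact mem_coNbr.2 ⟨this.2.2, this.1.symm⟩
    have h5 : 2 * t ≤ W.card := by
      have := hdeg u
      change 4 * t ≤ (N u).card at this
      omega
    calc 2 * (t * t) = 2 * t * t := by ring
      _ ≤ W.card * t := Nat.mul_le_mul_right _ h5
      _ ≤ (3 * p + 4) * (W.biUnion S).card := by
        rw [mul_comm (3 * p + 4)]; omega

/-- The number of edges from `S` to vertices with many neighbours in `S`. -/
theorem sum_card_clustered_le (hfree : ¬ G.Contains (L3theta3 p)) (S : Finset V) (K : ℕ)
    (hK : 2 * (p + 2) ≤ K) :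
    K * ∑ c ∈ S, (Finset.univ.filter fun z =>
        G.Adj c z ∧ K ≤ (S.filter fun x => G.Adj z x).card).card ≤
      8 * ((3 * p + 4) * (S.card * S.card)) := by
  let D : V → Finset V := fun z => S.filter fun x => G.Adj z x
  let σ : V → ℕ := fun z =>
    ∑ x ∈ D z, ((D z).filter fun y => LightPair G (3 * p + 4) x y).card
  have h1 : ∑ c ∈ S, (Finset.univ.filter fun z => G.Adj c z ∧ K ≤ (D z).card).card =
      ∑ z, (S.filter fun c => G.Adj c z ∧ K ≤ (D z).card).card :=
    Finset.sum_card_bipartiteAbove_eq_sum_card_bipartiteBelow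
      fun c z => G.Adj c z ∧ K ≤ (D z).card
  have h2 : ∀ z, K * (S.filter fun c => G.Adj c z ∧ K ≤ (D z).card).card ≤ 8 * σ z := by
    intro z
    by_cases hz : K ≤ (D z).card
    · have h3 : (S.filter fun c => G.Adj c z ∧ K ≤ (D z).card) = D z := by
        simp only [hz, and_true, D, G.adj_comm]
      rw [h3]
      have h4 := sq_card_le_sum_light hfree z (D z) (fun x hx => (Finset.mem_filter.1 hx).2)
      change _ ≤ 4 * σ z + _ at h4
      have h5 : K * (D z).card ≤ (D z).card * (D z).card := Nat.mul_le_mul_right _ hz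
      have h6 : 2 * (p + 2) * (D z).card ≤ K * (D z).card := Nat.mul_le_mul_right _ hK
      rw [mul_assoc] at h6
      omega
    · simp [hz]
  have h3 : ∑ z, σ z ≤ (3 * p + 4) * (S.card * S.card) := by
    have h4 : ∀ z, σ z = ∑ x ∈ S, ∑ y ∈ S,
        if G.Adj z x ∧ G.Adj z y ∧ LightPair G (3 * p + 4) x y then 1 else 0 := by
      intro z
      simp only [σ, D, Finset.sum_filter, Finset.card_filter, ite_and]
      refine Finset.sum_congr rfl fun x _ => ?_
      split_ifs <;> simp
    simp only [h4]
    rw [Finset.sum_comm]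
    have h5 : ∀ x ∈ S, (∑ z, ∑ y ∈ S,
        if G.Adj z x ∧ G.Adj z y ∧ LightPair G (3 * p + 4) x y then 1 else 0) ≤
        S.card * (3 * p + 4) := by
      intro x _
      rw [Finset.sum_comm, ← smul_eq_mul]
      refine Finset.sum_le_card_nsmul _ _ _ fun y _ => ?_
      rw [← Finset.card_filter]
      by_cases hxy : LightPair G (3 * p + 4) x y
      · refine le_trans (Finset.card_le_card fun z hz => ?_) hxy.2.le
        have := (Finset.mem_filter.1 hz).2
        exact mem_coNbr.2 ⟨this.1.symm, this.2.1.symm⟩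
      · simp [hxy]
    refine (Finset.sum_le_card_nsmul _ _ _ h5).trans ?_
    rw [smul_eq_mul]
    exact le_of_eq (by ring)
  change K * ∑ c ∈ S, (Finset.univ.filter fun z => G.Adj c z ∧ K ≤ (D z).card).card ≤ _
  rw [h1, Finset.mul_sum]
  calc _ ≤ ∑ z, 8 * σ z := Finset.sum_le_sum fun z _ => h2 z
    _ = 8 * ∑ z, σ z := by rw [Finset.mul_sum]
    _ ≤ _ := Nat.mul_le_mul_left _ h3

/-- If every fibre of `π` on `X` has at most `t` elements, then at least half of the vertices `c`
of `X` have few neighbours adjacent to many vertices of the fibre of `c`. -/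
theorem card_le_two_mul_card_unclustered (hfree : ¬ G.Contains (L3theta3 p)) (t : ℕ) (ht : 0 < t)
    (X : Finset V) (π : V → V) (hfib : ∀ w, (X.filter fun c => π c = w).card ≤ t) :
    X.card ≤ 2 * (X.filter fun c => 2 * (Finset.univ.filter fun z => G.Adj c z ∧
      32 * (3 * p + 4) ≤ (X.filter fun x => π x = π c ∧ G.Adj z x).card).card ≤ t).card := by
  let cl : V → ℕ := fun c => (Finset.univ.filter fun z => G.Adj c z ∧
      32 * (3 * p + 4) ≤ (X.filter fun x => π x = π c ∧ G.Adj z x).card).card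
  have hsum : 4 * ∑ c ∈ X, cl c ≤ t * X.card := by
    rw [← Finset.sum_fiberwise X π cl, Finset.card_eq_sum_card_fiberwise (f := π)
      (t := Finset.univ) (by simp), Finset.mul_sum, Finset.mul_sum]
    refine Finset.sum_le_sum fun w _ => ?_
    have h1 := sum_card_clustered_le hfree (X.filter fun c => π c = w) (32 * (3 * p + 4))
      (by omega)
    have h2 : ∑ c ∈ X.filter (fun c => π c = w), cl c =
        ∑ c ∈ X.filter (fun c => π c = w), (Finset.univ.filter fun z => G.Adj c z ∧
          32 * (3 * p + 4) ≤
            ((X.filter fun c => π c = w).filter fun x => G.Adj z x).card).card := by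
      refine Finset.sum_congr rfl fun c hc => ?_
      simp only [cl, (Finset.mem_filter.1 hc).2, Finset.filter_filter]
    rw [← h2] at h1
    have h3 : 4 * ∑ c ∈ X.filter (fun c => π c = w), cl c ≤
        (X.filter fun c => π c = w).card * (X.filter fun c => π c = w).card := by
      have : (3 * p + 4) * 8 * (4 * ∑ c ∈ X.filter (fun c => π c = w), cl c) ≤
        (3 * p + 4) * 8 *
          ((X.filter fun c => π c = w).card * (X.filter fun c => π c = w).card) := by linarith
      exact Nat.le_of_mul_le_mul_left this (by omega)
    exact h3.trans (Nat.mul_le_mul_right _ (hfib w))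
  have hpart := Finset.card_filter_add_card_filter_not (s := X) (fun c => 2 * cl c ≤ t)
  have hbad : (X.filter fun c => ¬ 2 * cl c ≤ t).card * t ≤ 2 * ∑ c ∈ X, cl c := by
    calc _ ≤ ∑ c ∈ X.filter (fun c => ¬ 2 * cl c ≤ t), 2 * cl c := by
          rw [← smul_eq_mul]
          refine Finset.card_nsmul_le_sum _ _ _ fun x hx => ?_
          have := (Finset.mem_filter.1 hx).2
          omega
      _ ≤ ∑ c ∈ X, 2 * cl c := Finset.sum_le_sum_of_subset (Finset.filter_subset _ _)
      _ = _ := by rw [Finset.mul_sum]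
  have h4 : t * (2 * (X.filter fun c => ¬ 2 * cl c ≤ t).card) ≤ t * X.card := by linarith
  have h5 := Nat.le_of_mul_le_mul_left h4 ht
  change X.card ≤ 2 * (X.filter fun c => 2 * cl c ≤ t).card
  omega

end Counting

/-- The arithmetic that concludes the counting of paths. -/
theorem pow_five_le_of_path_count {t p L n x S s T : ℕ} (hL : L = 3 * p + 4) (ht : 0 < t)
    (hS : t * x ≤ S) (hsq : S * S ≤ n * (4 * s + (p + 2) * S)) (hlow : t * s ≤ T)
    (hup : T ≤ L * (L * (1 + L + 32 * L)) * (x * n)) (hx : t * t ≤ L * x) :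
    t ^ 5 ≤ 272 * L ^ 4 * n ^ 2 := by
  by_contra hcon
  push Not at hcon
  have hLpos : 0 < L := by omega
  have hxpos : 0 < x := by
    rcases Nat.eq_zero_or_pos x with rfl | h
    · nlinarith
    · exact h
  have hcube : 16 * L ^ 2 * n < t ^ 3 := by
    refine lt_of_pow_lt_pow_left₀ 2 (by positivity) ?_
    calc (16 * L ^ 2 * n) ^ 2 = 256 * (L ^ 4 * n ^ 2) := by ring
      _ ≤ 272 * (L ^ 4 * n ^ 2) := Nat.mul_le_mul_right _ (by norm_num)
      _ = 272 * L ^ 4 * n ^ 2 := by ring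
      _ < t ^ 5 := hcon
      _ ≤ t ^ 6 := Nat.pow_le_pow_right ht (by norm_num)
      _ = (t ^ 3) ^ 2 := by ring
  have hLS : t ^ 3 ≤ L * S := by
    calc t ^ 3 = t * (t * t) := by ring
      _ ≤ t * (L * x) := Nat.mul_le_mul_left _ hx
      _ = L * (t * x) := by ring
      _ ≤ L * S := Nat.mul_le_mul_left _ hS
  have hSn : 16 * L * n ≤ S := by
    refine Nat.le_of_mul_le_mul_left ?_ hLpos
    calc L * (16 * L * n) = 16 * L ^ 2 * n := by ring
      _ ≤ L * S := hcube.le.trans hLS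
  have hSn' : 2 * (p + 2) * n ≤ S := le_trans (Nat.mul_le_mul_right _ (by omega)) hSn
  have hsq' : S * S ≤ 8 * n * s := by
    have := Nat.mul_le_mul_right S hSn'
    nlinarith
  have hmain : (t * x) * (t ^ 3 * x) ≤ (t * x) * (8 * n ^ 2 * (L * (L * (1 + L + 32 * L)))) := by
    calc (t * x) * (t ^ 3 * x) = t * (t * ((t * x) * (t * x))) := by ring
      _ ≤ t * (t * (S * S)) := by gcongr
      _ ≤ t * (t * (8 * n * s)) := by gcongr
      _ = t * (8 * n * (t * s)) := by ring
      _ ≤ t * (8 * n * (L * (L * (1 + L + 32 * L)) * (x * n))) := by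
        exact Nat.mul_le_mul_left _ (Nat.mul_le_mul_left _ (hlow.trans hup))
      _ = _ := by ring
  have hmain' := Nat.le_of_mul_le_mul_left hmain (Nat.mul_pos ht hxpos)
  refine absurd hcon (not_lt.2 ?_)
  calc t ^ 5 = t ^ 3 * (t * t) := by ring
    _ ≤ t ^ 3 * (L * x) := Nat.mul_le_mul_left _ hx
    _ = L * (t ^ 3 * x) := by ring
    _ ≤ L * (8 * n ^ 2 * (L * (L * (1 + L + 32 * L)))) := Nat.mul_le_mul_left _ hmain'
    _ ≤ L * (8 * n ^ 2 * (L * (L * (L + L + 32 * L)))) := by gcongr; omega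
    _ = 272 * L ^ 4 * n ^ 2 := by ring

section Assembly

open scoped Classical

variable {V : Type*} [Fintype V] {G : SimpleGraph V} {p : ℕ}

/-- Many paths `a, β c, c, z` together with the tree given by `u` and `π` contain a copy of
`L₃(θ_{3,p})`. -/
theorem contains_of_many_paths (L K : ℕ) (u a z : V) (X C : Finset V) (π β : V → V)
    (hua : u ≠ a) (huz : u ≠ z) (haz : a ≠ z) (hzπ : z ≠ π a)
    (huπ : G.Adj u (π a)) (haπ : G.Adj a (π a)) (hCX : C ⊆ X)
    (hπ : ∀ c ∈ C, G.Adj u (π c) ∧ G.Adj c (π c))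
    (hβ : ∀ c ∈ C, G.Adj a (β c) ∧ G.Adj (β c) c ∧ β c ≠ π c ∧ LightPair G L (β c) z)
    (hz : ∀ c ∈ C, G.Adj c z ∧ (X.filter fun x => π x = π c ∧ G.Adj z x).card ≤ K)
    (hcard : (3 * p + 4) * (1 + L + K) < C.card) :
    G.Contains (L3theta3 p) := by
  let F : V → Finset V := fun c => {c, β c, π c}
  have hmult : ∀ v, (C.filter fun c => v ∈ F c).card ≤ 1 + L + K := by
    intro v
    have hsub : (C.filter fun c => v ∈ F c) ⊆
        {v} ∪ (C.filter fun c => β c = v) ∪ (C.filter fun c => π c = v) := by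
      intro c hc
      obtain ⟨h1, h2⟩ := Finset.mem_filter.1 hc
      simp only [F, Finset.mem_insert, Finset.mem_singleton] at h2
      simp only [Finset.mem_union, Finset.mem_singleton, Finset.mem_filter]
      rcases h2 with h | h | h
      · simp [h]
      · simp [h, h1]
      · simp [h, h1]
    have hL : (C.filter fun c => β c = v).card ≤ L := by
      rcases (C.filter fun c => β c = v).eq_empty_or_nonempty with h | ⟨c, hc⟩
      · simp [h]
      · obtain ⟨h1, rfl⟩ := Finset.mem_filter.1 hc
        refine le_trans (Finset.card_le_card fun x hx => ?_) (hβ c h1).2.2.2.2.le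
        obtain ⟨h2, h3⟩ := Finset.mem_filter.1 hx
        exact mem_coNbr.2 ⟨h3 ▸ (hβ x h2).2.1, (hz x h2).1.symm⟩
    have hK : (C.filter fun c => π c = v).card ≤ K := by
      rcases (C.filter fun c => π c = v).eq_empty_or_nonempty with h | ⟨c, hc⟩
      · simp [h]
      · obtain ⟨h1, rfl⟩ := Finset.mem_filter.1 hc
        refine le_trans (Finset.card_le_card fun x hx => ?_) (hz c h1).2
        obtain ⟨h2, h3⟩ := Finset.mem_filter.1 hx
        exact Finset.mem_filter.2 ⟨hCX h2, h3, (hz x h2).1.symm⟩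
    calc _ ≤ _ := Finset.card_le_card hsub
      _ ≤ _ := Finset.card_union_le _ _
      _ ≤ _ := by
        gcongr
        refine (Finset.card_union_le _ _).trans ?_
        rw [Finset.card_singleton]
        gcongr
  obtain ⟨f, hf1, hf2, hf3⟩ := exists_disjoint_selection C F (1 + L + K) 3
    (fun c _ => Finset.card_le_three) hmult p {u, a, z, π a} (by
      refine lt_of_le_of_lt (Nat.mul_le_mul_right _ ?_) hcard
      gcongr
      exact Finset.card_le_four)
  have hF : ∀ i x, (x = f i ∨ x = β (f i) ∨ x = π (f i)) → x ∈ F (f i) := by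
    intro i x hx
    simpa [F] using hx
  refine contains_of_configuration u a z (π a) (fun i => β (f i)) f (fun i => π (f i))
    hua huz haz hzπ huπ haπ (fun i => (hβ _ (hf1 i)).1) (fun i => (hβ _ (hf1 i)).2.1)
    (fun i => (hz _ (hf1 i)).1) (fun i => (hπ _ (hf1 i)).2) (fun i => (hπ _ (hf1 i)).1)
    (fun i => (hβ _ (hf1 i)).2.2.1) ?_ ?_
  · intro i x hx
    have := Finset.disjoint_left.1 (hf2 i) (hF i x hx)
    simpa using this
  · intro i j hij x hx hx'
    exact Finset.disjoint_left.1 (hf3 i j hij) (hF i x hx) (hF j x hx')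

/-- A graph of large minimum degree contains `L₃(θ_{3,p})`. -/
theorem contains_of_minDegree [Nonempty V] (t : ℕ) (ht : p + 8 ≤ t)
    (hdeg : ∀ v, 4 * t ≤ (Finset.univ.filter fun y => G.Adj v y).card)
    (hcard : 272 * (3 * p + 4) ^ 4 * Fintype.card V ^ 2 < t ^ 5) :
    G.Contains (L3theta3 p) := by
  by_contra hfree
  obtain ⟨u, X₀, π, hX₀, hfib, hX₀card⟩ := exists_root hfree t (by omega) hdeg
  set L := 3 * p + 4 with hL
  let cl : V → V → Prop := fun c z =>
    32 * L ≤ (X₀.filter fun x => π x = π c ∧ G.Adj z x).card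
  have hX := card_le_two_mul_card_unclustered hfree t (by omega) X₀ π hfib
  rw [← hL] at hX
  set X := X₀.filter fun c => 2 * (Finset.univ.filter fun z => G.Adj c z ∧ cl c z).card ≤ t
    with hXdef
  change X₀.card ≤ 2 * X.card at hX
  let N : V → Finset V := fun v => Finset.univ.filter fun y => G.Adj v y
  have hN : ∀ v, 4 * t ≤ (N v).card := hdeg
  let E : V → V → Prop := fun c b => (G.Adj c b ∧
    (N c).card ≤ 2 * ((N c).filter fun y => LightPair G L b y).card + p + 2) ∧ b ≠ π c
  have hE : ∀ c, t ≤ (Finset.univ.filter fun b => E c b).card := by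
    intro c
    have h1 := card_le_two_mul_card_mostly_light hfree c (N c) (fun x hx => by simpa [N] using hx)
    rw [Finset.filter_filter, ← hL] at h1
    have h2 : (Finset.univ.filter fun b => E c b) = (Finset.univ.filter fun b => (G.Adj c b ∧
        (N c).card ≤ 2 * ((N c).filter fun y => LightPair G L b y).card + p + 2)).erase (π c) := by
      ext b; simp [E, and_comm]
    have h3 := Finset.pred_card_le_card_erase (s := Finset.univ.filter fun b => (G.Adj c b ∧
        (N c).card ≤ 2 * ((N c).filter fun y => LightPair G L b y).card + p + 2)) (a := π c)
    rw [← h2] at h3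
    have := hN c
    omega
  let Y : V → Finset V := fun b => X.filter fun c => E c b
  have hYX : ∀ b, Y b ⊆ X := fun b => Finset.filter_subset _ _
  have hYsum : t * X.card ≤ ∑ b, (Y b).card := by
    have h1 : ∑ c ∈ X, (Finset.univ.filter fun b => E c b).card = ∑ b, (Y b).card :=
      Finset.sum_card_bipartiteAbove_eq_sum_card_bipartiteBelow E
    rw [← h1, mul_comm, ← smul_eq_mul]
    exact Finset.card_nsmul_le_sum _ _ _ fun c _ => hE c
  let Z : V → V → V → Finset V := fun b c a => Finset.univ.filter fun z =>
    G.Adj c z ∧ LightPair G L b z ∧ ¬ cl c z ∧ z ≠ u ∧ z ≠ a ∧ z ≠ π a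
  have hZ : ∀ b, ∀ c ∈ Y b, ∀ a, t ≤ (Z b c a).card := by
    intro b c hc a
    obtain ⟨hcX, ⟨-, h1⟩, -⟩ := Finset.mem_filter.1 hc
    have h2 := (Finset.mem_filter.1 hcX).2
    have h3 : ((N c).filter fun y => LightPair G L b y) ⊆
        Z b c a ∪ (Finset.univ.filter fun z => G.Adj c z ∧ cl c z) ∪ {u, a, π a} := by
      intro z hz
      obtain ⟨h4, h5⟩ := Finset.mem_filter.1 hz
      have h6 : G.Adj c z := by simpa [N] using h4
      simp only [Z, Finset.mem_union, Finset.mem_filter, Finset.mem_univ, true_and,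
        Finset.mem_insert, Finset.mem_singleton]
      tauto
    have h4 := Finset.card_le_card h3
    have h5 := Finset.card_union_le
      (Z b c a ∪ (Finset.univ.filter fun z => G.Adj c z ∧ cl c z)) {u, a, π a}
    have h6 := Finset.card_union_le (Z b c a) (Finset.univ.filter fun z => G.Adj c z ∧ cl c z)
    have h7 : ({u, a, π a} : Finset V).card ≤ 3 := Finset.card_le_three
    have := hN c
    omega
  let T : Finset (Σ _ : V, Σ _ : V, Σ _ : V, V) := Finset.univ.sigma fun b =>
    (Y b).sigma fun c => ((Y b).filter fun a => LightPair G L c a).sigma fun a => Z b c a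
  let σ : V → ℕ := fun b => ∑ c ∈ Y b, ((Y b).filter fun a => LightPair G L c a).card
  have hTlower : t * ∑ b, σ b ≤ T.card := by
    simp only [T, σ, Finset.card_sigma, Finset.mul_sum]
    refine Finset.sum_le_sum fun b _ => Finset.sum_le_sum fun c hc => ?_
    rw [mul_comm, ← smul_eq_mul]
    exact Finset.card_nsmul_le_sum _ _ _ fun a _ => hZ b c hc a
  have hTmem : ∀ b c a z, (⟨b, c, a, z⟩ : Σ _ : V, Σ _ : V, Σ _ : V, V) ∈ T ↔
      c ∈ Y b ∧ (a ∈ Y b ∧ LightPair G L c a) ∧ z ∈ Z b c a := by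
    intro b c a z
    simp [T]
  have hTupper : T.card ≤ L * (L * (1 + L + 32 * L)) * (X.card * Fintype.card V) := by
    have hmaps : ∀ s ∈ T, (s.2.2.1, s.2.2.2) ∈ X ×ˢ (Finset.univ : Finset V) := by
      rintro ⟨b, c, a, z⟩ hs
      exact Finset.mem_product.2 ⟨hYX b ((hTmem b c a z).1 hs).2.1.1, Finset.mem_univ _⟩
    have hfibre : ∀ az ∈ X ×ˢ (Finset.univ : Finset V),
        (T.filter fun s => (s.2.2.1, s.2.2.2) = az).card ≤ L * (L * (1 + L + 32 * L)) := by
      rintro ⟨a, z⟩ haz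
      set Q := T.filter fun s => (s.2.2.1, s.2.2.2) = (a, z) with hQ
      have hQmem : ∀ s ∈ Q, ∃ b c, s = ⟨b, c, a, z⟩ ∧ c ∈ Y b ∧ (a ∈ Y b ∧ LightPair G L c a) ∧
          z ∈ Z b c a := by
        rintro ⟨b, c, a', z'⟩ hs
        obtain ⟨h1, h2⟩ := Finset.mem_filter.1 hs
        obtain ⟨rfl, rfl⟩ := Prod.mk.inj h2
        exact ⟨b, c, rfl, (hTmem _ _ _ _).1 h1⟩
      have h1 : Q.card ≤ L * (Q.image fun s => s.2.1).card := by
        refine Finset.card_le_mul_card_image Q L fun c hc => ?_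
        obtain ⟨s, hs, rfl⟩ := Finset.mem_image.1 hc
        obtain ⟨b, c, rfl, -, ⟨-, hca⟩, -⟩ := hQmem s hs
        refine le_trans (Finset.card_le_card_of_injOn (fun s => s.1) ?_ ?_) hca.2.le
        · intro s' hs'
          obtain ⟨h3, h4⟩ := Finset.mem_filter.1 hs'
          obtain ⟨b', c', rfl, h5, ⟨h6, -⟩, -⟩ := hQmem s' h3
          obtain rfl : c' = c := h4
          exact mem_coNbr.2 ⟨(Finset.mem_filter.1 h5).2.1.1, (Finset.mem_filter.1 h6).2.1.1⟩
        · intro s' hs' s'' hs'' h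
          obtain ⟨h3, h4⟩ := Finset.mem_filter.1 hs'
          obtain ⟨h5, h6⟩ := Finset.mem_filter.1 hs''
          obtain ⟨b', c', rfl, -⟩ := hQmem s' h3
          obtain ⟨b'', c'', rfl, -⟩ := hQmem s'' h5
          obtain rfl : c' = c := h4
          obtain rfl : c'' = c' := h6
          obtain rfl : b' = b'' := h
          rfl
      have h2 : (Q.image fun s => s.2.1).card ≤ L * (1 + L + 32 * L) := by
        by_contra hcon
        push Not at hcon
        have hβ : ∀ c, ∃ b, c ∈ (Q.image fun s => s.2.1) →
            c ∈ Y b ∧ (a ∈ Y b ∧ LightPair G L c a) ∧ z ∈ Z b c a := by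
          intro c
          by_cases hc : c ∈ Q.image fun s => s.2.1
          · obtain ⟨s, hs, rfl⟩ := Finset.mem_image.1 hc
            obtain ⟨b, c, rfl, h⟩ := hQmem s hs
            exact ⟨b, fun _ => h⟩
          · exact ⟨c, fun h => absurd h hc⟩
        choose β hβ using hβ
        obtain ⟨c₀, hc₀⟩ : (Q.image fun s => s.2.1).Nonempty := by
          rw [← Finset.card_pos]; omega
        have hz₀ := (Finset.mem_filter.1 (hβ c₀ hc₀).2.2).2
        have haX : a ∈ X₀ := (Finset.mem_filter.1 (Finset.mem_product.1 haz).1).1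
        have hsub : (Q.image fun s => s.2.1) ⊆ X₀ := fun c hc =>
          (Finset.mem_filter.1 (hYX _ (hβ c hc).1)).1
        refine hfree (contains_of_many_paths L (32 * L) u a z X₀ _ π β (hX₀ a haX).1.1
          hz₀.2.2.2.1.symm hz₀.2.2.2.2.1.symm hz₀.2.2.2.2.2 (hX₀ a haX).2.1 (hX₀ a haX).2.2 hsub
          (fun c hc => (hX₀ c (hsub hc)).2) ?_ ?_ hcon)
        · intro c hc
          obtain ⟨h3, ⟨h4, -⟩, h5⟩ := hβ c hc
          have h6 := (Finset.mem_filter.1 h3).2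
          exact ⟨(Finset.mem_filter.1 h4).2.1.1, h6.1.1.symm, h6.2,
            (Finset.mem_filter.1 h5).2.2.1⟩
        · intro c hc
          have h5 := (Finset.mem_filter.1 (hβ c hc).2.2).2
          exact ⟨h5.1, le_of_lt (not_le.1 h5.2.2.1)⟩
      exact h1.trans (Nat.mul_le_mul_left _ h2)
    have := Finset.card_le_mul_card_image_of_maps_to hmaps _ hfibre
    simpa [Finset.card_product] using this
  set n := Fintype.card V with hn
  set S := ∑ b, (Y b).card with hS
  have hσ : S * S ≤ n * (4 * ∑ b, σ b + (p + 2) * S) := by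
    have h1 : S ^ 2 ≤ n * ∑ b, (Y b).card ^ 2 := by
      have := sq_sum_le_card_mul_sum_sq (s := (Finset.univ : Finset V)) (f := fun b => (Y b).card)
      simpa using this
    have h2 : ∑ b, (Y b).card ^ 2 ≤ 4 * ∑ b, σ b + (p + 2) * S := by
      rw [hS, Finset.mul_sum, Finset.mul_sum, ← Finset.sum_add_distrib]
      refine Finset.sum_le_sum fun b _ => ?_
      rw [sq]
      exact sq_card_le_sum_light hfree b (Y b)
        (fun x hx => (Finset.mem_filter.1 hx).2.1.1.symm)
    rw [← sq]
    exact h1.trans (Nat.mul_le_mul_left _ h2)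
  have hXt : t * t ≤ L * X.card := by nlinarith
  exact absurd hcard
    (not_lt.2 (pow_five_le_of_path_count hL (by omega) hYsum hσ hTlower hTupper hXt))

end Assembly

/-- A finite graph with many edges has a nonempty set of vertices inducing a subgraph of large
minimum degree. -/
theorem exists_minDegree_finset {V : Type*} [Fintype V] (G : SimpleGraph V) (k : ℕ)
    (h : k * Fintype.card V < G.edgeSet.ncard) :
    ∃ S : Finset V, S.Nonempty ∧ ∀ v ∈ S, ∃ A : Finset V, A ⊆ S ∧ (∀ x ∈ A, G.Adj v x) ∧
      k < A.card := by
  classical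
  let e : Finset V → ℕ := fun S => ∑ v ∈ S, (S.filter fun x => G.Adj v x).card
  have huniv : 2 * k * (Finset.univ : Finset V).card < e Finset.univ := by
    have h1 : e Finset.univ = 2 * G.edgeFinset.card := by
      rw [← G.sum_degrees_eq_twice_card_edges]
      refine Finset.sum_congr rfl fun v _ => ?_
      rw [← G.card_neighborFinset_eq_degree, G.neighborFinset_eq_filter]
    have h2 : G.edgeSet.ncard = G.edgeFinset.card := by
      rw [← G.coe_edgeFinset, Set.ncard_coe_finset]
    rw [h1, ← h2, Finset.card_univ]
    linarith
  obtain ⟨S, hS, hmin⟩ := exists_minimal_of_wellFoundedLT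
    (fun S : Finset V => 2 * k * S.card < e S) ⟨_, huniv⟩
  refine ⟨S, ?_, ?_⟩
  · rw [Finset.nonempty_iff_ne_empty]
    rintro rfl
    simp [e] at hS
  · intro v hv
    refine ⟨S.filter fun x => G.Adj v x, Finset.filter_subset _ _,
      fun x hx => (Finset.mem_filter.1 hx).2, ?_⟩
    by_contra hcon
    push Not at hcon
    set S' := S.erase v with hS'
    have hvS' : v ∉ S' := by simp [hS']
    have hins : S = insert v S' := (Finset.insert_erase hv).symm
    have hfil : (S.filter fun x => G.Adj v x) = S'.filter fun x => G.Adj v x := by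
      rw [hins, Finset.filter_insert]; simp
    have he : e S = 2 * (S.filter fun x => G.Adj v x).card + e S' := by
      have h1 : ∀ y ∈ S', (S.filter fun x => G.Adj y x).card =
          (if G.Adj v y then 1 else 0) + (S'.filter fun x => G.Adj y x).card := by
        intro y _
        rw [hins, Finset.filter_insert]
        by_cases hy : G.Adj v y
        · rw [if_pos hy.symm, if_pos hy, Finset.card_insert_of_notMem (by simp [hvS']), add_comm]
        · rw [if_neg (fun h => hy h.symm), if_neg hy, zero_add]
      have h2 : e S = (S.filter fun x => G.Adj v x).card +
          ∑ y ∈ S', (S.filter fun x => G.Adj y x).card := by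
        simp only [e]
        rw [← Finset.add_sum_erase S _ hv]
      rw [h2, Finset.sum_congr rfl h1, Finset.sum_add_distrib, ← Finset.card_filter, hfil]
      ring
    have hlt : 2 * k * S'.card < e S' := by
      have h3 : S.card = S'.card + 1 := by rw [hins, Finset.card_insert_of_notMem hvS']
      rw [he, h3] at hS
      nlinarith
    exact hvS' (hmin hlt (Finset.erase_subset _ _) hv)

/-- A graph with more than `12^4 p^6 n^{7/5}` edges contains `L₃(θ_{3,p})`. -/
theorem contains_of_many_edges {n p : ℕ} (hp : 2 ≤ p) (G : SimpleGraph (Fin n))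
    (h : (12 : ℝ) ^ 4 * (p : ℝ) ^ 6 * (n : ℝ) ^ ((7 : ℝ) / 5) < (G.edgeSet.ncard : ℝ)) :
    G.Contains (L3theta3 p) := by
  classical
  set C : ℝ := (12 : ℝ) ^ 4 * (p : ℝ) ^ 6 with hC
  have hn : 0 < n := by
    rcases Nat.eq_zero_or_pos n with rfl | hn
    · exfalso
      have h1 : G.edgeSet.ncard = 0 := by
        rw [Set.ncard_eq_zero, Set.eq_empty_iff_forall_notMem]
        intro x
        induction x with
        | h a b => exact a.elim0
      rw [h1] at h
      norm_num at h
    · exact hn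
  have hn' : (1 : ℝ) ≤ n := by exact_mod_cast hn
  have hp' : (2 : ℝ) ≤ p := by exact_mod_cast hp
  have hCpos : 0 < C := by positivity
  set r : ℝ := (n : ℝ) ^ ((2 : ℝ) / 5) with hr
  have hr1 : 1 ≤ r := Real.one_le_rpow hn' (by norm_num)
  have hr5 : r ^ 5 = (n : ℝ) ^ 2 := by
    rw [hr, ← Real.rpow_natCast, ← Real.rpow_mul (by positivity), ← Real.rpow_natCast]
    norm_num
  have hrn : (n : ℝ) ^ ((7 : ℝ) / 5) = r * n := by
    rw [hr, ← Real.rpow_add_one (by positivity)]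
    norm_num
  set k := ⌊C * r⌋₊ with hk
  have hk1 : (k : ℝ) ≤ C * r := Nat.floor_le (by positivity)
  have hk2 : C * r < k + 1 := Nat.lt_floor_add_one _
  have hkn : k * Fintype.card (Fin n) < G.edgeSet.ncard := by
    rw [Fintype.card_fin]
    have : (k : ℝ) * n < G.edgeSet.ncard := by
      refine lt_of_le_of_lt ?_ h
      rw [hrn, ← mul_assoc]
      gcongr
    exact_mod_cast this
  obtain ⟨S, hSne, hS⟩ := exists_minDegree_finset G k hkn
  have hcardS : Fintype.card S ≤ n := by
    simpa using Finset.card_le_univ S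
  set t := (k + 1) / 4 with ht
  have hp6 : (p : ℝ) ≤ p ^ 6 := le_self_pow₀ (by linarith) (by norm_num)
  have hCp : 12 ^ 4 * (p : ℝ) ≤ C := by rw [hC]; gcongr
  have hCr : C ≤ C * r := le_mul_of_one_le_right hCpos.le hr1
  have hkp : 12 ^ 4 * p ≤ k := by
    rw [hk]
    refine Nat.le_floor ?_
    push_cast
    linarith
  have ht8 : k + 1 ≤ 8 * t := by omega
  have htr : C * r ≤ 8 * t := by
    have : ((k + 1 : ℕ) : ℝ) ≤ ((8 * t : ℕ) : ℝ) := by exact_mod_cast ht8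
    push_cast at this
    linarith
  have hmain : 272 * (3 * p + 4) ^ 4 * n ^ 2 < t ^ 5 := by
    have h1 : (C * r) ^ 5 ≤ (8 * (t : ℝ)) ^ 5 := by gcongr
    have h2 : (12 ^ 4 * (p : ℝ)) ^ 5 ≤ C ^ 5 := by gcongr
    have h3 : (3 * (p : ℝ) + 4) ^ 4 ≤ (5 * p) ^ 4 := by gcongr; linarith
    have h4 : (p : ℝ) ^ 4 ≤ p ^ 5 := pow_le_pow_right₀ (by linarith) (by norm_num)
    have h5 : 0 < (p : ℝ) ^ 4 := by positivity
    have h6 : 8 ^ 5 * (272 * (3 * (p : ℝ) + 4) ^ 4) < C ^ 5 := by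
      have : (12 ^ 4 * (p : ℝ)) ^ 5 = 12 ^ 20 * p ^ 5 := by ring
      have : (5 * (p : ℝ)) ^ 4 = 625 * p ^ 4 := by ring
      nlinarith
    have h7 : 8 ^ 5 * (272 * (3 * (p : ℝ) + 4) ^ 4) * (n : ℝ) ^ 2 < 8 ^ 5 * (t : ℝ) ^ 5 := by
      calc _ < C ^ 5 * (n : ℝ) ^ 2 := by gcongr
        _ = (C * r) ^ 5 := by rw [mul_pow C r, hr5]
        _ ≤ (8 * (t : ℝ)) ^ 5 := h1
        _ = _ := by ring
    have h8 : 272 * (3 * (p : ℝ) + 4) ^ 4 * (n : ℝ) ^ 2 < (t : ℝ) ^ 5 := by linarith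
    exact_mod_cast h8
  have : Nonempty S := hSne.to_subtype
  have hcon : (G.comap ((↑) : S → Fin n)).Contains (L3theta3 p) := by
    refine contains_of_minDegree t (by omega) ?_ ?_
    · intro v
      obtain ⟨A, hAS, hA, hAk⟩ := hS v v.2
      calc 4 * t ≤ A.card := by omega
        _ = (A.subtype (· ∈ S)).card := by
          rw [Finset.card_subtype, Finset.filter_true_of_mem fun x hx => hAS hx]
        _ ≤ _ := by
          refine Finset.card_le_card fun x hx => ?_
          simpa using hA x (by simpa using hx)
    · refine lt_of_le_of_lt ?_ hmain
      gcongr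
  obtain ⟨f, hf⟩ := hcon
  refine ⟨⟨fun x => (f x : Fin n), fun hxy => f.map_rel hxy⟩, fun x y hxy => hf (Subtype.ext hxy)⟩

/-- For every $p ≥ 2$ and all $n$, $ex(n, L_3(θ_{3,p})) ≤ 12^4 · p^6 · n^{7/5}$. -/
theorem ex_L3theta3_upper (p : ℕ) (hp : 2 ≤ p) (n : ℕ) :
    (exNum n (L3theta3 p) : ℝ) ≤ (12 : ℝ) ^ 4 * (p : ℝ) ^ 6 * (n : ℝ) ^ ((7 : ℝ) / 5) := by
  refine le_trans (Nat.cast_le.2 (csSup_le' ?_)) (Nat.floor_le (by positivity))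
  rintro _ ⟨G, hG, rfl⟩
  refine Nat.le_floor (not_lt.1 fun h => hG (contains_of_many_edges hp G h))
end

section
/- There exists a function ℓ : ℕ → ℕ such that for all integers s ≥ 2 and t ≥ ℓ(s) there exists a constant c > 0 with ex(n, H_{s,t}) ≥ c · n^{2 - 2/(2s+1)} for all sufficiently large n. -/
open SimpleGraph Filter

/-- The graph `H_{s,t}`: two vertex-disjoint copies of `K_{s,t}` together with a perfect
matching joining the two images of every vertex of `K_{s,t}`. -/
def Hgraph (s t : ℕ) : SimpleGraph ((Fin s ⊕ Fin t) × Bool) :=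
  SimpleGraph.fromRel fun x y =>
    (x.2 = y.2 ∧ (completeBipartiteGraph (Fin s) (Fin t)).Adj x.1 y.1) ∨
    (x.2 ≠ y.2 ∧ x.1 = y.1)

section HilbertFunction

open MvPolynomial Module

variable {σ τ F : Type*} [Field F]

/-- The maximal ideal of polynomials vanishing at a rational point. -/
noncomputable def pointIdeal (p : σ → F) : Ideal (MvPolynomial σ F) :=
  RingHom.ker (MvPolynomial.eval p)

theorem mem_pointIdeal {p : σ → F} {f : MvPolynomial σ F} :
    f ∈ pointIdeal p ↔ eval p f = 0 := RingHom.mem_ker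

instance pointIdeal_isPrime (p : σ → F) : (pointIdeal p).IsPrime :=
  RingHom.ker_isPrime _

/-- The image in the quotient by `J` of the polynomials of total degree at most `m`. -/
noncomputable def truncation (J : Ideal (MvPolynomial σ F)) (m : ℕ) :
    Submodule F (MvPolynomial σ F ⧸ J) :=
  (restrictTotalDegree σ F m).map (Ideal.Quotient.mkₐ F J).toLinearMap

/-- The affine Hilbert function of an ideal of a polynomial ring. -/
noncomputable def hilbertFn (J : Ideal (MvPolynomial σ F)) (m : ℕ) : ℕ :=
  finrank F (truncation J m)

theorem mk_mem_truncation {J : Ideal (MvPolynomial σ F)} {m : ℕ} {f : MvPolynomial σ F}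
    (hf : f.totalDegree ≤ m) : Ideal.Quotient.mk J f ∈ truncation J m :=
  Submodule.mem_map_of_mem (f := (Ideal.Quotient.mkₐ F J).toLinearMap)
    ((mem_restrictTotalDegree _ _ _).2 hf)

theorem exists_of_mem_truncation {J : Ideal (MvPolynomial σ F)} {m : ℕ}
    {x : MvPolynomial σ F ⧸ J} (hx : x ∈ truncation J m) :
    ∃ f : MvPolynomial σ F, f.totalDegree ≤ m ∧ Ideal.Quotient.mk J f = x := by
  obtain ⟨f, hf, rfl⟩ := hx
  exact ⟨f, (mem_restrictTotalDegree _ _ _).1 hf, rfl⟩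

variable [Finite σ]

instance truncation_finite (J : Ideal (MvPolynomial σ F)) (m : ℕ) :
    Module.Finite F (truncation J m) := by
  unfold truncation; infer_instance

theorem hilbertFn_mono (J : Ideal (MvPolynomial σ F)) : Monotone (hilbertFn J) := by
  intro a b hab
  refine Submodule.finrank_mono fun x hx => ?_
  obtain ⟨f, hf, rfl⟩ := exists_of_mem_truncation hx
  exact mk_mem_truncation (hf.trans hab)

theorem hilbertFn_le_pow [Fintype σ] (J : Ideal (MvPolynomial σ F)) (m : ℕ) :
    hilbertFn J m ≤ (m + 1) ^ Fintype.card σ := by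
  classical
  let mon : (σ → Fin (m + 1)) → MvPolynomial σ F ⧸ J := fun e =>
    Ideal.Quotient.mk J (monomial (Finsupp.equivFunOnFinite.symm fun i => (e i : ℕ)) 1)
  have hle : truncation J m ≤ Submodule.span F (Set.range mon) := by
    intro x hx
    obtain ⟨f, hf, rfl⟩ := exists_of_mem_truncation hx
    rw [f.as_sum, map_sum]
    refine Submodule.sum_mem _ fun v hv => ?_
    have hvi : ∀ i, v i < m + 1 := fun i => Nat.lt_succ_of_le <|
      ((degreeOf_le_iff.1 (degreeOf_le_totalDegree f i)) v hv).trans hf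
    have : Ideal.Quotient.mk J (monomial v (coeff v f)) =
        coeff v f • mon fun i => ⟨v i, hvi i⟩ := by
      have h1 : (Finsupp.equivFunOnFinite.symm fun i => v i) = v := by ext; simp
      simp only [mon, h1]
      rw [← Ideal.Quotient.mkₐ_eq_mk F, ← map_smul, smul_monomial, smul_eq_mul, mul_one]
    rw [this]
    exact Submodule.smul_mem _ _ (Submodule.subset_span ⟨_, rfl⟩)
  have : Module.Finite F (Submodule.span F (Set.range mon)) :=
    FiniteDimensional.span_of_finite F (Set.finite_range mon)
  calc hilbertFn J m ≤ finrank F (Submodule.span F (Set.range mon)) := Submodule.finrank_mono hle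
    _ ≤ Fintype.card (σ → Fin (m + 1)) := finrank_range_le_card mon
    _ = (m + 1) ^ Fintype.card σ := by simp

theorem hilbertFn_add_le {J J' : Ideal (MvPolynomial σ F)} (h : J ≤ J') {f : MvPolynomial σ F}
    (hf : f ∈ J') (hreg : ∀ g, f * g ∈ J → g ∈ J) {D : ℕ} (hD : f.totalDegree ≤ D) (m : ℕ) :
    hilbertFn J' (m + D) + hilbertFn J m ≤ hilbertFn J (m + D) := by
  let φ : (MvPolynomial σ F ⧸ J) →ₗ[F] MvPolynomial σ F ⧸ J' :=
    (Ideal.Quotient.factorₐ F h).toLinearMap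
  let U := truncation J (m + D)
  let μ : (MvPolynomial σ F ⧸ J) →ₗ[F] MvPolynomial σ F ⧸ J :=
    LinearMap.mulLeft F (Ideal.Quotient.mk J f)
  have hμ : Function.Injective μ := by
    rw [injective_iff_map_eq_zero]
    intro x hx
    obtain ⟨g, rfl⟩ := Ideal.Quotient.mk_surjective x
    have : Ideal.Quotient.mk J (f * g) = 0 := by rw [map_mul]; exact hx
    exact Ideal.Quotient.eq_zero_iff_mem.2 (hreg g (Ideal.Quotient.eq_zero_iff_mem.1 this))
  have hU' : truncation J' (m + D) = U.map φ := by
    simp only [U, truncation]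
    rw [← Submodule.map_comp]
    rfl
  have hsub : (truncation J m).map μ ≤ U ⊓ LinearMap.ker φ := by
    rintro _ ⟨x, hx, rfl⟩
    obtain ⟨g, hg, rfl⟩ := exists_of_mem_truncation hx
    have e : μ (Ideal.Quotient.mk J g) = Ideal.Quotient.mk J (f * g) := (map_mul _ _ _).symm
    rw [e]
    refine ⟨mk_mem_truncation ((totalDegree_mul _ _).trans (by omega)), ?_⟩
    change Ideal.Quotient.mk J' (f * g) = 0
    exact Ideal.Quotient.eq_zero_iff_mem.2 (J'.mul_mem_right g hf)
  have hrank := (φ.domRestrict U).finrank_range_add_finrank_ker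
  rw [LinearMap.range_domRestrict, ← hU'] at hrank
  have hker : hilbertFn J m ≤ finrank F (LinearMap.ker (φ.domRestrict U)) := by
    have e1 : hilbertFn J m = finrank F ((truncation J m).map μ) :=
      (Submodule.equivMapOfInjective μ hμ _).finrank_eq
    have e2 : (LinearMap.ker (φ.domRestrict U)).map U.subtype = U ⊓ LinearMap.ker φ := by
      ext x; simp [LinearMap.mem_ker, and_comm]
    have e3 : finrank F ((LinearMap.ker (φ.domRestrict U)).map U.subtype) =
        finrank F (LinearMap.ker (φ.domRestrict U)) :=
      (Submodule.equivMapOfInjective U.subtype U.subtype_injective _).finrank_eq.symm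
    rw [e1, ← e3, e2]
    have : Module.Finite F ↥(U ⊓ LinearMap.ker φ) :=
      Submodule.finiteDimensional_inf_left U _
    exact Submodule.finrank_mono hsub
  simp only [hilbertFn] at hker ⊢
  have : finrank F U = finrank F (truncation J (m + D)) := rfl
  omega

end HilbertFunction

section PrimeChains

open MvPolynomial Module

/-- There is a strictly increasing chain of `d + 1` primes from `P` to `Q`. -/
def HasPrimeChain {R : Type*} [CommRing R] (d : ℕ) (P Q : Ideal R) : Prop :=
  ∃ c : LTSeries (PrimeSpectrum R), c.length = d ∧ c.head.asIdeal = P ∧ c.last.asIdeal = Q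

namespace HasPrimeChain

variable {R : Type*} [CommRing R] {d : ℕ} {P Q : Ideal R}

theorem isPrime (h : HasPrimeChain d P Q) : P.IsPrime := by
  obtain ⟨c, -, rfl, -⟩ := h
  exact c.head.isPrime

theorem le (h : HasPrimeChain d P Q) : P ≤ Q := by
  obtain ⟨c, -, rfl, rfl⟩ := h
  exact c.head_le_last

theorem refl (P : Ideal R) [hP : P.IsPrime] : HasPrimeChain 0 P P :=
  ⟨RelSeries.singleton _ ⟨P, hP⟩, rfl, rfl, rfl⟩

theorem cons {P' : Ideal R} (h : HasPrimeChain d P' Q) [hP : P.IsPrime] (hlt : P < P') :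
    HasPrimeChain (d + 1) P Q := by
  obtain ⟨c, rfl, rfl, rfl⟩ := h
  exact ⟨RelSeries.cons c ⟨P, hP⟩ hlt, by simp, by simp, by simp⟩

theorem lt (h : HasPrimeChain (d + 1) P Q) : P < Q := by
  obtain ⟨c, hc, rfl, rfl⟩ := h
  exact c.strictMono (show (0 : Fin (c.length + 1)) < Fin.last _ by
    rw [Fin.lt_def]; simp [hc])

theorem exists_mem [IsNoetherianRing R] (h : HasPrimeChain (d + 1) P Q) {f : R} (hf : f ∈ Q) :
    ∃ P', P ≤ P' ∧ f ∈ P' ∧ HasPrimeChain d P' Q := by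
  obtain ⟨c, hc, rfl, rfl⟩ := h
  obtain ⟨q, hq, hlen, hhead, hlast⟩ := PrimeSpectrum.exist_ltSeries_mem_one_of_mem_last c hf
  have hq0 : q.length ≠ 0 := by omega
  refine ⟨(q 1).asIdeal, ?_, hq, q.tail hq0, ?_, ?_, ?_⟩
  · rw [hhead]
    exact q.monotone (Fin.zero_le 1)
  · simp [← hlen, hc]
  · simp
  · simp [hlast]

end HasPrimeChain

variable {σ F : Type*} [Field F]

theorem hasPrimeChain_bot_pointIdeal {n : ℕ} (p : Fin n → F) :
    HasPrimeChain n (⊥ : Ideal (MvPolynomial (Fin n) F)) (pointIdeal p) := by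
  let φ : ℕ → MvPolynomial (Fin n) F →ₐ[F] MvPolynomial (Fin n) F := fun k =>
    aeval fun i => if (i : ℕ) < k then C (p i) else X i
  have hprime : ∀ k, (RingHom.ker (φ k)).IsPrime := fun k => RingHom.ker_isPrime _
  have hφ : ∀ k ≤ n, HasPrimeChain k (RingHom.ker (φ (n - k))) (RingHom.ker (φ n)) := by
    intro k
    induction k with
    | zero => intro _; exact HasPrimeChain.refl (RingHom.ker (φ n))
    | succ k ih =>
      intro hk
      refine (ih (by omega)).cons (lt_of_le_of_ne ?_ ?_)
      · have hcomp : φ (n - k) = (φ (n - k)).comp (φ (n - (k + 1))) := by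
          ext i : 1
          simp only [φ, AlgHom.comp_apply, aeval_X]
          split_ifs with h1 h2 h2
          · simp
          · simp [h1]
          · omega
          · simp [h1]
        intro x hx
        rw [RingHom.mem_ker] at hx ⊢
        rw [hcomp, AlgHom.comp_apply, hx, map_zero]
      · intro heq
        let i : Fin n := ⟨n - (k + 1), by omega⟩
        have h1 : (X i - C (p i) : MvPolynomial (Fin n) F) ∈ RingHom.ker (φ (n - k)) := by
          simp [RingHom.mem_ker, φ, i, show n - (k + 1) < n - k by omega]
        rw [← heq, RingHom.mem_ker] at h1
        simp only [φ, map_sub, aeval_X, i, lt_irrefl, if_false, algHom_C, algebraMap_eq] at h1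
        have h2 := congrArg (eval fun j => p j + 1) h1
        simp at h2
  have hbot : RingHom.ker (φ (n - n)) = ⊥ := by
    have : φ (n - n) = AlgHom.id F _ := by ext i : 1; simp [φ]
    rw [this, RingHom.ker_eq_bot_iff_eq_zero]
    simp
  have htop : RingHom.ker (φ n) = pointIdeal p := by
    ext f
    have : φ n f = C (eval p f) := by
      have : φ n = (Algebra.ofId F (MvPolynomial (Fin n) F)).comp (aeval p) := by
        ext i : 1
        simp [φ, Algebra.ofId_apply]
      rw [this]
      simp [Algebra.ofId_apply, aeval_eq_eval]
    rw [RingHom.mem_ker, this, mem_pointIdeal, C_eq_zero]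
  have := hφ n le_rfl
  rwa [hbot, htop] at this

theorem exists_transcendental_variable {p : σ → F} {P : Ideal (MvPolynomial σ F)} [P.IsPrime]
    (hlt : P < pointIdeal p) :
    ∃ v : σ, ∀ g : Polynomial F, Polynomial.aeval (X v : MvPolynomial σ F) g ∈ P → g = 0 := by
  by_contra! hcon
  have hintegral : Algebra.IsIntegral F (MvPolynomial σ F ⧸ P) := by
    constructor
    intro x
    obtain ⟨f, rfl⟩ := Ideal.Quotient.mk_surjective x
    induction f using MvPolynomial.induction_on with
    | C a => exact isIntegral_algebraMap (A := MvPolynomial σ F ⧸ P) (x := a)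
    | add f g hf hg => rw [map_add]; exact hf.add hg
    | mul_X f v hf =>
      rw [map_mul]
      refine hf.mul ?_
      obtain ⟨g, hg, hg0⟩ := hcon v
      refine IsAlgebraic.isIntegral ⟨g, hg0, ?_⟩
      rw [← Ideal.Quotient.mkₐ_eq_mk F, Polynomial.aeval_algHom_apply]
      exact Ideal.Quotient.eq_zero_iff_mem.2 hg
  have hmax : P.IsMaximal := Ideal.Quotient.maximal_of_isField _
    (isField_of_isIntegral_of_isField' (R := F) (Field.toIsField F))
  exact (pointIdeal_isPrime p).ne_top (hmax.1.2 _ hlt)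

theorem exists_separating_polynomial [DecidableEq (σ → F)] (A : Finset (σ → F)) {p : σ → F}
    (hp : p ∉ A) :
    ∃ g : MvPolynomial σ F, g.totalDegree ≤ A.card ∧ eval p g ≠ 0 ∧ ∀ a ∈ A, eval a g = 0 := by
  have hne : ∀ a : A, ∃ i, p i ≠ a.1 i := fun a => by
    by_contra! h
    exact hp (funext h ▸ a.2)
  choose l hl using hne
  refine ⟨∏ a : A, (X (l a) - C (a.1 (l a))), ?_, ?_, ?_⟩
  · refine (totalDegree_finsetProd _ _).trans ?_
    calc _ ≤ ∑ a : A, 1 := Finset.sum_le_sum fun a _ =>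
          (totalDegree_sub_C_le _ _).trans (by simp)
      _ = A.card := by simp
  · rw [map_prod]
    exact Finset.prod_ne_zero_iff.2 fun a _ => by simpa [sub_eq_zero] using hl a
  · intro a ha
    rw [map_prod]
    exact Finset.prod_eq_zero (Finset.mem_univ ⟨a, ha⟩) (by simp)

end PrimeChains

section PrimeCovers

open MvPolynomial Module TensorProduct

variable {σ τ F : Type*} [Field F]

/-- A choice, for every point of `T`, of a prime `P p` below the ideal of the point and joined to it
by a chain of length `d`, such that the Hilbert function of the intersection of all the `P p`
grows like a polynomial of degree `d`. -/
structure IsPrimeCover (D d C : ℕ) (T : Set (σ → F))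
    (P : (σ → F) → Ideal (MvPolynomial σ F)) : Prop where
  chain : ∀ p ∈ T, HasPrimeChain d (P p) (pointIdeal p)
  growth : ∀ j, 1 ≤ j → hilbertFn (⨅ p ∈ T, P p) (j * D) ≤ C * j ^ d

theorem isPrimeCover_bot {n D : ℕ} (hD : 1 ≤ D) (T : Set (Fin n → F)) :
    IsPrimeCover D n ((2 * D) ^ n) T fun _ => ⊥ where
  chain p _ := hasPrimeChain_bot_pointIdeal p
  growth j hj := by
    refine (hilbertFn_le_pow _ _).trans ?_
    rw [← mul_pow, Fintype.card_fin]
    refine Nat.pow_le_pow_left ?_ n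
    nlinarith [Nat.mul_le_mul hj hD]

theorem IsPrimeCover.mono {D d C C' : ℕ} {T : Set (σ → F)}
    {P : (σ → F) → Ideal (MvPolynomial σ F)} (h : IsPrimeCover D d C T P) (hC : C ≤ C') :
    IsPrimeCover D d C' T P where
  chain := h.chain
  growth j hj := (h.growth j hj).trans (Nat.mul_le_mul_right _ hC)

theorem IsPrimeCover.cut [Finite σ] {D d C : ℕ} {T : Set (σ → F)}
    {P : (σ → F) → Ideal (MvPolynomial σ F)} (h : IsPrimeCover D (d + 1) C T P)
    {f : MvPolynomial σ F} (hD : f.totalDegree ≤ D) (hf : ∀ p ∈ T, f ∉ P p) :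
    ∃ P', IsPrimeCover D d (C * 2 ^ (d + 1)) {p | p ∈ T ∧ eval p f = 0} P' := by
  have hex : ∀ p, ∃ P', p ∈ T → eval p f = 0 →
      P p ≤ P' ∧ f ∈ P' ∧ HasPrimeChain d P' (pointIdeal p) := by
    intro p
    by_cases hp : p ∈ T
    · by_cases h0 : eval p f = 0
      · obtain ⟨P', hP'⟩ := (h.chain p hp).exists_mem (mem_pointIdeal.2 h0)
        exact ⟨P', fun _ _ => hP'⟩
      · exact ⟨⊥, fun _ h => absurd h h0⟩
    · exact ⟨⊥, fun h => absurd h hp⟩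
  choose P' hP' using hex
  refine ⟨P', fun p hp => (hP' p hp.1 hp.2).2.2, fun j hj => ?_⟩
  set J := ⨅ p ∈ T, P p with hJ
  set J' := ⨅ p ∈ {p | p ∈ T ∧ eval p f = 0}, P' p with hJ'
  have hle : J ≤ J' := le_iInf₂ fun p hp =>
    (iInf₂_le (f := fun p (_ : p ∈ T) => P p) p hp.1).trans (hP' p hp.1 hp.2).1
  have hfJ' : f ∈ J' := by
    simp only [hJ', Ideal.mem_iInf]
    exact fun p hp => (hP' p hp.1 hp.2).2.1
  have hreg : ∀ g, f * g ∈ J → g ∈ J := by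
    intro g hg
    simp only [hJ, Ideal.mem_iInf] at hg ⊢
    intro p hp
    exact ((h.chain p hp).isPrime.mem_or_mem (hg p hp)).resolve_left (hf p hp)
  have hstep : ∀ i, hilbertFn J' (j * D) * i ≤ hilbertFn J ((j + i) * D) := by
    intro i
    induction i with
    | zero => simp
    | succ i ih =>
      have h1 := hilbertFn_add_le hle hfJ' hreg hD ((j + i) * D)
      have h2 : hilbertFn J' (j * D) ≤ hilbertFn J' ((j + i) * D + D) :=
        hilbertFn_mono J' (by nlinarith [Nat.zero_le (i * D)])
      rw [show (j + (i + 1)) * D = (j + i) * D + D by ring, mul_add, mul_one]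
      omega
  have h1 := (hstep j).trans (h.growth (j + j) (by omega))
  have h2 : C * (j + j) ^ (d + 1) = (C * 2 ^ (d + 1) * j ^ d) * j := by
    rw [← two_mul, mul_pow, pow_succ j]; ring
  rw [h2] at h1
  exact Nat.le_of_mul_le_mul_right h1 hj

theorem IsPrimeCover.card_le [Finite σ] {D C : ℕ} (hD : 1 ≤ D) {T : Finset (σ → F)}
    {P : (σ → F) → Ideal (MvPolynomial σ F)} (h : IsPrimeCover D 0 C (T : Set (σ → F)) P) :
    T.card ≤ C := by
  classical
  set J := ⨅ p ∈ (T : Set (σ → F)), P p with hJ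
  have hJle : ∀ p ∈ T, J ≤ pointIdeal p := fun p hp =>
    (iInf₂_le (f := fun p (_ : p ∈ (T : Set (σ → F))) => P p) p hp).trans (h.chain p hp).le
  have hsep : ∀ p : T, ∃ g : MvPolynomial σ F,
      g.totalDegree ≤ T.card ∧ eval p.1 g ≠ 0 ∧ ∀ a ∈ T.erase p.1, eval a g = 0 := fun p => by
    obtain ⟨g, h1, h2⟩ := exists_separating_polynomial (T.erase p.1) (Finset.notMem_erase p.1 T)
    exact ⟨g, h1.trans (Finset.card_erase_le), h2⟩
  choose g hgd hg1 hg0 using hsep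
  have hdeg : T.card ≤ (T.card + 1) * D := by nlinarith
  let v : T → truncation J ((T.card + 1) * D) := fun p =>
    ⟨Ideal.Quotient.mk J (g p), mk_mem_truncation ((hgd p).trans hdeg)⟩
  have hv : LinearIndependent F v := by
    rw [Fintype.linearIndependent_iff]
    intro c hc p
    have h1 : ∑ q, c q • Ideal.Quotient.mk J (g q) = 0 := by
      have := congrArg Subtype.val hc
      simpa [v] using this
    have h2 : ∑ q, c q • g q ∈ J := by
      rw [← Ideal.Quotient.eq_zero_iff_mem, ← Ideal.Quotient.mkₐ_eq_mk F, map_sum]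
      simpa using h1
    have h3 := mem_pointIdeal.1 (hJle p.1 p.2 h2)
    rw [map_sum, Finset.sum_eq_single p] at h3
    · simpa [smul_eval, hg1 p] using h3
    · intro q _ hq
      rw [smul_eval, hg0 q p.1 (Finset.mem_erase.2 ⟨fun h => hq (Subtype.ext h.symm), p.2⟩),
        mul_zero]
    · simp
  have := hv.fintype_card_le_finrank
  rw [Fintype.card_coe] at this
  exact this.trans ((h.growth _ (by omega)).trans (by simp))

theorem hilbertFn_sum_le [Fintype σ] [Fintype τ] {J₁ : Ideal (MvPolynomial σ F)}
    {J₂ : Ideal (MvPolynomial τ F)} {J : Ideal (MvPolynomial (σ ⊕ τ) F)}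
    (h₁ : ∀ g ∈ J₁, rename Sum.inl g ∈ J) (h₂ : ∀ g ∈ J₂, rename Sum.inr g ∈ J) (m : ℕ) :
    hilbertFn J m ≤ hilbertFn J₁ m * hilbertFn J₂ m := by
  let φ₁ : (MvPolynomial σ F ⧸ J₁) →ₐ[F] MvPolynomial (σ ⊕ τ) F ⧸ J :=
    Ideal.Quotient.liftₐ J₁ ((Ideal.Quotient.mkₐ F J).comp (rename Sum.inl))
      fun g hg => Ideal.Quotient.eq_zero_iff_mem.2 (h₁ g hg)
  let φ₂ : (MvPolynomial τ F ⧸ J₂) →ₐ[F] MvPolynomial (σ ⊕ τ) F ⧸ J :=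
    Ideal.Quotient.liftₐ J₂ ((Ideal.Quotient.mkₐ F J).comp (rename Sum.inr))
      fun g hg => Ideal.Quotient.eq_zero_iff_mem.2 (h₂ g hg)
  let β : truncation J₁ m →ₗ[F] truncation J₂ m →ₗ[F] MvPolynomial (σ ⊕ τ) F ⧸ J :=
    (LinearMap.mul F _).compl₁₂ (φ₁.toLinearMap.domRestrict _) (φ₂.toLinearMap.domRestrict _)
  let ψ := TensorProduct.lift β
  have hle : truncation J m ≤ LinearMap.range ψ := by
    intro x hx
    obtain ⟨f, hf, rfl⟩ := exists_of_mem_truncation hx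
    rw [f.as_sum, map_sum]
    refine Submodule.sum_mem _ fun v hv => ?_
    have hvd : (v.sum fun _ e => e) ≤ m := (le_totalDegree hv).trans hf
    rw [Finsupp.sum_fintype _ _ (by simp), Fintype.sum_sum_type] at hvd
    let u₁ : σ →₀ ℕ := Finsupp.equivFunOnFinite.symm fun i => v (Sum.inl i)
    let u₂ : τ →₀ ℕ := Finsupp.equivFunOnFinite.symm fun i => v (Sum.inr i)
    have hu₁ : (monomial u₁ (coeff v f)).totalDegree ≤ m := by
      refine (totalDegree_monomial_le _ _).trans ?_
      rw [Finsupp.sum_fintype _ _ (by simp)]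
      exact (Nat.le_add_right _ _).trans hvd
    have hu₂ : (monomial u₂ (1 : F)).totalDegree ≤ m := by
      refine (totalDegree_monomial_le _ _).trans ?_
      rw [Finsupp.sum_fintype _ _ (by simp)]
      exact (Nat.le_add_left _ _).trans hvd
    have hprod : monomial v (coeff v f) =
        rename Sum.inl (monomial u₁ (coeff v f)) * rename Sum.inr (monomial u₂ (1 : F)) := by
      simp only [monomial_eq, Finsupp.prod_fintype, pow_zero, implies_true, Fintype.prod_sum_type,
        map_mul, map_prod, map_pow, rename_X, rename_C, u₁, u₂,
        Finsupp.equivFunOnFinite_symm_apply_apply, map_one, one_mul, mul_assoc]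
    refine ⟨⟨_, mk_mem_truncation hu₁⟩ ⊗ₜ[F] ⟨_, mk_mem_truncation hu₂⟩, ?_⟩
    rw [hprod, map_mul]
    rfl
  calc hilbertFn J m ≤ finrank F (LinearMap.range ψ) := Submodule.finrank_mono hle
    _ ≤ finrank F (TensorProduct F (truncation J₁ m) (truncation J₂ m)) :=
      LinearMap.finrank_range_le _
    _ = _ := finrank_tensorProduct

/-- Going down along the flat extension `F[τ] → F[τ] ⊗ A`, below the fibre over a point. -/
theorem exists_prime_le_ker_of_lt {A : Type*} [CommRing A] [IsDomain A] [Algebra F A]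
    {P₂ : Ideal (MvPolynomial τ F)} [P₂.IsPrime] {y : τ → F} (h : P₂ < pointIdeal y)
    (ε : MvPolynomial τ F ⊗[F] A →ₐ[F] A)
    (hε : ∀ g : MvPolynomial τ F, ε (g ⊗ₜ[F] (1 : A)) = algebraMap F A (eval y g)) :
    ∃ Q : Ideal (MvPolynomial τ F ⊗[F] A), Q.IsPrime ∧ Q ≤ RingHom.ker ε ∧
      ∀ g : MvPolynomial τ F, g ⊗ₜ[F] (1 : A) ∈ Q ↔ g ∈ P₂ := by
  have hprime : (RingHom.ker ε).IsPrime := RingHom.ker_isPrime _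
  have hover : (RingHom.ker ε).LiesOver (pointIdeal y) := by
    constructor
    ext g
    rw [Ideal.mem_under, mem_pointIdeal, RingHom.mem_ker]
    change _ ↔ ε (g ⊗ₜ[F] (1 : A)) = 0
    rw [hε, map_eq_zero_iff _ (FaithfulSMul.algebraMap_injective F A)]
  obtain ⟨Q, hlt, hQ, hover'⟩ := Ideal.exists_ideal_lt_liesOver_of_lt (RingHom.ker ε) h
  refine ⟨Q, hQ, hlt.le, fun g => ?_⟩
  rw [Q.over_def P₂, Ideal.mem_under]
  rfl

theorem exists_hasPrimeChain_sum {P₁ : Ideal (MvPolynomial σ F)} {P₂ : Ideal (MvPolynomial τ F)}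
    {p : σ ⊕ τ → F} (h₁ : HasPrimeChain 1 P₁ (pointIdeal (p ∘ Sum.inl)))
    (h₂ : HasPrimeChain 1 P₂ (pointIdeal (p ∘ Sum.inr))) :
    ∃ P, HasPrimeChain 2 P (pointIdeal p) ∧ (∀ g ∈ P₁, rename Sum.inl g ∈ P) ∧
      ∀ g ∈ P₂, rename Sum.inr g ∈ P := by
  have := h₁.isPrime
  have := h₂.isPrime
  obtain ⟨A, _, _, _, π, hπ, hker⟩ : ∃ (A : Type _) (_ : CommRing A) (_ : IsDomain A)
      (_ : Algebra F A) (π : MvPolynomial σ F →ₐ[F] A), Function.Surjective π ∧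
      ∀ g, π g = 0 ↔ g ∈ P₁ :=
    ⟨MvPolynomial σ F ⧸ P₁, inferInstance, inferInstance, inferInstance, Ideal.Quotient.mkₐ F P₁,
      Ideal.Quotient.mkₐ_surjective F P₁, fun g => Ideal.Quotient.eq_zero_iff_mem⟩
  let θ : MvPolynomial (σ ⊕ τ) F →ₐ[F] MvPolynomial τ F ⊗[F] A :=
    aeval (Sum.elim (fun i => (1 : MvPolynomial τ F) ⊗ₜ[F] π (X i))
      fun j => (X j : MvPolynomial τ F) ⊗ₜ[F] (1 : A))
  let ε : MvPolynomial τ F ⊗[F] A →ₐ[F] A := Algebra.TensorProduct.lift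
    ((Algebra.ofId F A).comp (aeval (p ∘ Sum.inr))) (AlgHom.id F A) fun _ _ => Commute.all _ _
  have hθ₁ : ∀ g, θ (rename Sum.inl g) = (1 : MvPolynomial τ F) ⊗ₜ[F] π g := by
    have : θ.comp (rename Sum.inl) =
        (Algebra.TensorProduct.includeRight : A →ₐ[F] MvPolynomial τ F ⊗[F] A).comp π := by
      ext i : 1
      simp [θ]
    exact fun g => DFunLike.congr_fun this g
  have hθ₂ : ∀ g, θ (rename Sum.inr g) = g ⊗ₜ[F] (1 : A) := by
    have : θ.comp (rename Sum.inr) =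
        (Algebra.TensorProduct.includeLeft : MvPolynomial τ F →ₐ[F] MvPolynomial τ F ⊗[F] A) := by
      ext i : 1
      simp [θ]
    exact fun g => DFunLike.congr_fun this g
  have hε : ∀ g : MvPolynomial τ F, ε (g ⊗ₜ[F] (1 : A)) =
      algebraMap F A (eval (p ∘ Sum.inr) g) := by
    intro g
    simp [ε, Algebra.ofId_apply, aeval_eq_eval]
  have hprime : (RingHom.ker ε).IsPrime := RingHom.ker_isPrime _
  obtain ⟨Q, hQ, hle, hmem⟩ := exists_prime_le_ker_of_lt h₂.lt ε hε
  have hεθ : ∀ g, ε (θ g) = 0 → eval p g = 0 := by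
    have : ε.comp θ = π.comp (aeval (Sum.elim X fun j => C (p (Sum.inr j)))) := by
      ext i : 1
      rcases i with i | i
      · simp [θ, ε]
      · simp [θ, ε, Algebra.ofId_apply, ← algebraMap_eq]
    intro g hg
    have h0 := DFunLike.congr_fun this g
    rw [AlgHom.comp_apply, hg, AlgHom.comp_apply, eq_comm, hker] at h0
    have h3 := mem_pointIdeal.1 (h₁.le h0)
    have h4 : (aeval (p ∘ Sum.inl)).comp (aeval (Sum.elim X fun j => C (p (Sum.inr j)))) =
        aeval (R := F) p := by
      ext i : 1
      rcases i with i | i <;> simp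
    have h5 := DFunLike.congr_fun h4 g
    simp only [AlgHom.comp_apply, aeval_eq_eval] at h5
    exact h5.symm.trans h3
  refine ⟨Q.comap θ, ((HasPrimeChain.refl _).cons (P := (RingHom.ker ε).comap θ) ?_).cons ?_,
    ?_, ?_⟩
  · refine lt_of_le_of_ne (fun g hg => mem_pointIdeal.2 (hεθ g hg)) fun heq => ?_
    obtain ⟨g, hg, hg'⟩ := SetLike.exists_of_lt h₁.lt
    have h3 : rename Sum.inl g ∈ (RingHom.ker ε).comap θ := by
      rw [heq, mem_pointIdeal, eval_rename]
      exact mem_pointIdeal.1 hg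
    rw [Ideal.mem_comap, hθ₁, RingHom.mem_ker] at h3
    exact hg' ((hker g).1 (by simpa [ε] using h3))
  · refine lt_of_le_of_ne (Ideal.comap_mono hle) fun heq => ?_
    obtain ⟨g, hg, hg'⟩ := SetLike.exists_of_lt h₂.lt
    have h3 : rename Sum.inr g ∈ (RingHom.ker ε).comap θ := by
      rw [Ideal.mem_comap, hθ₂, RingHom.mem_ker, hε, mem_pointIdeal.1 hg, map_zero]
    rw [← heq, Ideal.mem_comap, hθ₂, hmem] at h3
    exact hg' h3
  · intro g hg
    rw [Ideal.mem_comap, hθ₁, (hker g).2 hg, tmul_zero]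
    exact Q.zero_mem
  · intro g hg
    rw [Ideal.mem_comap, hθ₂]
    exact (hmem g).2 hg

theorem IsPrimeCover.sum [Fintype σ] [Fintype τ] {D C₁ C₂ : ℕ} {T₁ : Set (σ → F)}
    {T₂ : Set (τ → F)} {P₁ : (σ → F) → Ideal (MvPolynomial σ F)}
    {P₂ : (τ → F) → Ideal (MvPolynomial τ F)} (h₁ : IsPrimeCover D 1 C₁ T₁ P₁)
    (h₂ : IsPrimeCover D 1 C₂ T₂ P₂) {T : Set (σ ⊕ τ → F)}
    (hT : ∀ p ∈ T, p ∘ Sum.inl ∈ T₁ ∧ p ∘ Sum.inr ∈ T₂) :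
    ∃ P, IsPrimeCover D 2 (C₁ * C₂) T P := by
  have hex : ∀ p, ∃ P, p ∈ T → HasPrimeChain 2 P (pointIdeal p) ∧
      (∀ g ∈ P₁ (p ∘ Sum.inl), rename Sum.inl g ∈ P) ∧
      ∀ g ∈ P₂ (p ∘ Sum.inr), rename Sum.inr g ∈ P := by
    intro p
    by_cases hp : p ∈ T
    · obtain ⟨P, hP⟩ := exists_hasPrimeChain_sum (h₁.chain _ (hT p hp).1) (h₂.chain _ (hT p hp).2)
      exact ⟨P, fun _ => hP⟩
    · exact ⟨⊥, fun h => absurd h hp⟩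
  choose P hP using hex
  refine ⟨P, fun p hp => (hP p hp).1, fun j hj => ?_⟩
  refine (hilbertFn_sum_le (J₁ := ⨅ p ∈ T₁, P₁ p) (J₂ := ⨅ p ∈ T₂, P₂ p) ?_ ?_ _).trans ?_
  · intro g hg
    simp only [Ideal.mem_iInf] at hg ⊢
    exact fun p hp => (hP p hp).2.1 g (hg _ (hT p hp).1)
  · intro g hg
    simp only [Ideal.mem_iInf] at hg ⊢
    exact fun p hp => (hP p hp).2.2 g (hg _ (hT p hp).2)
  · calc _ ≤ (C₁ * j ^ 1) * (C₂ * j ^ 1) := Nat.mul_le_mul (h₁.growth j hj) (h₂.growth j hj)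
      _ = C₁ * C₂ * j ^ 2 := by ring

end PrimeCovers

section Counting

open MvPolynomial Module

variable {σ τ F : Type*} [Field F]

/-- A set of parameters which each line `c ↦ η - w c` meets at most once is small. -/
theorem ncard_mul_pow_le {Ω A V : Type*} [AddCommGroup Ω] [Finite Ω] [Finite V]
    (pre : Ω → A) (B : Set Ω) (w : A → V → Ω) (hw : ∀ a ω c, pre (ω + w a c) = pre ω)
    (hB : ∀ η c c', η - w (pre η) c ∈ B → η - w (pre η) c' ∈ B → c = c') :
    B.ncard * Nat.card V ≤ Nat.card Ω := by
  rw [← Set.ncard_univ V, ← Set.ncard_prod, ← Set.ncard_univ Ω]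
  refine Set.ncard_le_ncard_of_injOn (fun x => x.1 + w (pre x.1) x.2) (fun _ _ => trivial) ?_
  rintro ⟨ω, c⟩ ⟨hω, -⟩ ⟨ω', c'⟩ ⟨hω', -⟩ h
  simp only at h hω hω'
  have hpre : pre ω = pre ω' := by
    rw [← hw (pre ω) ω c, h, hw]
  have h1 : (ω + w (pre ω) c) - w (pre (ω + w (pre ω) c)) c = ω := by
    rw [hw, add_sub_cancel_right]
  have h2 : (ω + w (pre ω) c) - w (pre (ω + w (pre ω) c)) c' = ω' := by
    rw [hw, h, hpre, add_sub_cancel_right]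
  have hc : c = c' := hB (ω + w (pre ω) c) c c' (by rwa [h1]) (by rwa [h2])
  subst hc
  rw [hpre] at h
  rw [add_right_cancel h]

/-- For all but few parameters, cutting by the polynomial `cur ω` lowers the dimension of a
prime cover of a set depending on `pre ω`. -/
theorem ncard_not_cut_mul_le [Finite σ] [Finite F] {Ω A V : Type*} [AddCommGroup Ω] [Finite Ω]
    [Finite V] {D d C : ℕ} (pre : Ω → A) (cur : Ω → MvPolynomial σ F)
    (hdeg : ∀ ω, (cur ω).totalDegree ≤ D) (T : A → Set (σ → F))
    (hrich : ∀ a, ∀ p ∈ T a, ∀ P : Ideal (MvPolynomial σ F), P.IsPrime → P < pointIdeal p →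
      ∃ w : V → Ω, (∀ ω c, pre (ω + w c) = pre ω) ∧
        ∀ η c c', cur (η - w c) ∈ P → cur (η - w c') ∈ P → c = c') :
    {ω | ¬ ∃ P, IsPrimeCover D d (C * 2 ^ (d + 1))
        {p | p ∈ T (pre ω) ∧ eval p (cur ω) = 0} P}.ncard * Nat.card V ≤
      {ω | ¬ ∃ P, IsPrimeCover D (d + 1) C (T (pre ω)) P}.ncard * Nat.card V +
      Nat.card (σ → F) * Nat.card Ω := by
  classical
  have := Fintype.ofFinite (σ → F)
  have hex : ∀ a, ∃ P, (∃ P, IsPrimeCover D (d + 1) C (T a) P) → IsPrimeCover D (d + 1) C (T a) P :=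
    fun a => by
      by_cases h : ∃ P, IsPrimeCover D (d + 1) C (T a) P
      · obtain ⟨P, hP⟩ := h
        exact ⟨P, fun _ => hP⟩
      · exact ⟨fun _ => ⊥, fun h' => absurd h' h⟩
  choose Q hQ using hex
  let B : (σ → F) → Set Ω := fun p =>
    {ω | (∃ P, IsPrimeCover D (d + 1) C (T (pre ω)) P) ∧ p ∈ T (pre ω) ∧ cur ω ∈ Q (pre ω) p}
  have hsub : {ω | ¬ ∃ P, IsPrimeCover D d (C * 2 ^ (d + 1))
        {p | p ∈ T (pre ω) ∧ eval p (cur ω) = 0} P} ⊆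
      {ω | ¬ ∃ P, IsPrimeCover D (d + 1) C (T (pre ω)) P} ∪ ⋃ p, B p := by
    intro ω h2
    by_contra hcon
    rw [Set.mem_union, not_or] at hcon
    obtain ⟨h1, hcon⟩ := hcon
    replace h1 := not_not.1 h1
    simp only [Set.mem_iUnion, not_exists] at hcon
    exact h2 ((hQ _ h1).cut (hdeg ω) fun p hp hmem => hcon p ⟨h1, hp, hmem⟩)
  have hBp : ∀ p, (B p).ncard * Nat.card V ≤ Nat.card Ω := by
    intro p
    have hw : ∀ a, ∃ w : V → Ω, (∀ ω c, pre (ω + w c) = pre ω) ∧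
        ((∃ P, IsPrimeCover D (d + 1) C (T a) P) → p ∈ T a →
          ∀ η c c', cur (η - w c) ∈ Q a p → cur (η - w c') ∈ Q a p → c = c') := fun a => by
      by_cases h : (∃ P, IsPrimeCover D (d + 1) C (T a) P) ∧ p ∈ T a
      · have hch := (hQ a h.1).chain p h.2
        obtain ⟨w, h1, h2⟩ := hrich a p h.2 (Q a p) hch.isPrime hch.lt
        exact ⟨w, h1, fun _ _ => h2⟩
      · exact ⟨fun _ => 0, by simp, fun h1 h2 => absurd ⟨h1, h2⟩ h⟩
    choose w hw1 hw2 using hw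
    refine ncard_mul_pow_le pre (B p) w hw1 fun η c c' hc hc' => ?_
    have hpre : ∀ c, pre (η - w (pre η) c) = pre η := fun c => by
      rw [← hw1 (pre η) (η - w (pre η) c) c, sub_add_cancel]
    simp only [B, Set.mem_ofPred_eq, hpre] at hc hc'
    exact hw2 _ hc.1 hc.2.1 η c c' hc.2.2 hc'.2.2
  have hU : (⋃ p, B p).ncard * Nat.card V ≤ Nat.card (σ → F) * Nat.card Ω :=
    calc (⋃ p, B p).ncard * Nat.card V ≤ (∑ p, (B p).ncard) * Nat.card V :=
          Nat.mul_le_mul_right _ (Set.ncard_iUnion_le_of_fintype _)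
      _ = ∑ p, (B p).ncard * Nat.card V := Finset.sum_mul _ _ _
      _ ≤ ∑ _p : σ → F, Nat.card Ω := Finset.sum_le_sum fun p _ => hBp p
      _ = _ := by simp
  refine (Nat.mul_le_mul_right _ ((Set.ncard_le_ncard hsub (Set.toFinite _)).trans
    (Set.ncard_union_le _ _))).trans ?_
  rw [add_mul]
  exact Nat.add_le_add_left hU _

/-- The polynomial with coefficients `c` in the single variable `X v`. -/
noncomputable def varPoly {M : ℕ} (v : σ) (c : Fin M → F) : MvPolynomial σ F :=
  ∑ j, C (c j) * X v ^ (j : ℕ)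

theorem totalDegree_varPoly_le {M : ℕ} (v : σ) (c : Fin M → F) : (varPoly v c).totalDegree ≤ M :=
  totalDegree_finsetSum_le fun j _ => by
    refine (totalDegree_mul _ _).trans ?_
    rw [totalDegree_C, zero_add]
    refine (totalDegree_pow _ _).trans ?_
    rw [totalDegree_X, mul_one]
    exact j.2.le

theorem exists_varPoly_injective {p : σ → F} {P : Ideal (MvPolynomial σ F)} [P.IsPrime]
    (hlt : P < pointIdeal p) (M : ℕ) :
    ∃ v : σ, ∀ c c' : Fin M → F, varPoly v c - varPoly v c' ∈ P → c = c' := by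
  obtain ⟨v, hv⟩ := exists_transcendental_variable hlt
  refine ⟨v, fun c c' h => ?_⟩
  let g : Polynomial F := ∑ j : Fin M, Polynomial.C (c j - c' j) * Polynomial.X ^ (j : ℕ)
  have hg : g = 0 := by
    refine hv g ?_
    convert h using 1
    simp only [g, varPoly, map_sum, map_mul, map_pow, Polynomial.aeval_X, Polynomial.aeval_C,
      ← Finset.sum_sub_distrib, ← sub_mul, ← C_sub, algebraMap_eq]
  funext j
  have hj := congrArg (fun g => Polynomial.coeff g (j : ℕ)) hg
  simp only [g, Polynomial.finsetSum_coeff, Polynomial.coeff_C_mul, Polynomial.coeff_X_pow,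
    Polynomial.coeff_zero, mul_ite, mul_one, mul_zero, Fin.val_inj, Finset.sum_ite_eq,
    Finset.mem_univ, if_true] at hj
  exact sub_eq_zero.1 hj

end Counting

section Curves

open MvPolynomial Module

variable {σ τ ρ F : Type*} [Field F]

theorem totalDegree_aeval_le {g : ρ → MvPolynomial τ F} (hg : ∀ r, (g r).totalDegree ≤ 1)
    (f : MvPolynomial ρ F) : (aeval g f).totalDegree ≤ f.totalDegree := by
  rw [aeval_def, eval₂_eq]
  refine totalDegree_finsetSum_le fun d hd => (totalDegree_mul _ _).trans ?_
  rw [algebraMap_eq, totalDegree_C, zero_add]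
  refine (totalDegree_finsetProd _ _).trans ((Finset.sum_le_sum fun i _ => ?_).trans
    (le_totalDegree hd))
  exact (totalDegree_pow _ _).trans (by simpa using Nat.mul_le_mul_left (d i) (hg i))

/-- Substitution of polynomials for the variables, on polynomials of bounded degree. -/
noncomputable def substHom (D : ℕ) (g : ρ → MvPolynomial τ F) :
    restrictTotalDegree ρ F D →+ MvPolynomial τ F :=
  ((aeval g).toLinearMap.domRestrict _).toAddMonoidHom

theorem substHom_apply (D : ℕ) (g : ρ → MvPolynomial τ F) (f : restrictTotalDegree ρ F D) :
    substHom D g f = aeval g f.1 := rfl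

theorem totalDegree_substHom_le (D : ℕ) {g : ρ → MvPolynomial τ F}
    (hg : ∀ r, (g r).totalDegree ≤ 1) (f : restrictTotalDegree ρ F D) :
    (substHom D g f).totalDegree ≤ D :=
  (totalDegree_aeval_le hg _).trans ((mem_restrictTotalDegree _ _ _).1 f.2)

theorem exists_substHom_eq_varPoly {ι : Type*} [Fintype ι] {D M : ℕ} (hD : Fintype.card ι + M ≤ D)
    (g : ι → ρ → MvPolynomial τ F) {a : ι → σ → F} (ha : Function.Injective a) (l : σ → ρ)
    (r : τ → ρ) (hl : ∀ i x, g i (l x) = C (a i x)) (hr : ∀ i y, g i (r y) = X y)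
    (i : ι) (v : τ) :
    ∃ w : (Fin M → F) → restrictTotalDegree ρ F D, ∀ c,
      substHom D (g i) (w c) = varPoly v c ∧ ∀ i' ≠ i, substHom D (g i') (w c) = 0 := by
  classical
  obtain ⟨h, hdeg, hne, h0⟩ := exists_separating_polynomial
    ((Finset.univ.erase i).image a) (p := a i) (by simp [ha.eq_iff])
  have hcard : h.totalDegree ≤ Fintype.card ι :=
    hdeg.trans (Finset.card_image_le.trans (Finset.card_le_univ _))
  have hL : ∀ i', aeval (g i') (rename l h) = C (eval (a i') h) := fun i' => by
    rw [aeval_rename, show g i' ∘ l = fun x => C (a i' x) from funext (hl i')]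
    exact aeval_algebraMap_apply (MvPolynomial τ F) (a i') h
  have hR : ∀ i' (f : MvPolynomial τ F), aeval (g i') (rename r f) = f := fun i' f => by
    rw [aeval_rename, show g i' ∘ r = X from funext (hr i'), aeval_X_left_apply]
  refine ⟨fun c => ⟨C (eval (a i) h)⁻¹ * (rename l h * rename r (varPoly v c)),
    (mem_restrictTotalDegree _ _ _).2 ?_⟩, fun c => ⟨?_, fun i' hi' => ?_⟩⟩
  · refine (totalDegree_mul _ _).trans ?_
    rw [totalDegree_C, zero_add]
    refine (totalDegree_mul _ _).trans ((add_le_add ((totalDegree_rename_le _ _).trans hcard)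
      ((totalDegree_rename_le _ _).trans (totalDegree_varPoly_le v c))).trans hD)
  · rw [substHom_apply, map_mul, map_mul, hL, hR, aeval_C, algebraMap_eq, ← mul_assoc, ← C_mul,
      inv_mul_cancel₀ hne, C_1, one_mul]
  · rw [substHom_apply, map_mul, map_mul, hL, h0 (a i') (Finset.mem_image_of_mem _ (by simp [hi'])),
      C_0, zero_mul, mul_zero]

theorem ncard_not_isPrimeCover_mul_le [Finite F] {N D M : ℕ} (hD : 1 ≤ D) {ι κ Ω₀ : Type*}
    [AddCommGroup Ω₀] [Finite Ω₀] [Finite κ] (E : ι → Ω₀ →+ MvPolynomial (Fin N) F)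
    (hdeg : ∀ i f, (E i f).totalDegree ≤ D)
    (hE : ∀ i v, ∃ w : (Fin M → F) → Ω₀, ∀ c, E i (w c) = varPoly v c ∧ ∀ i' ≠ i, E i' (w c) = 0)
    (B : Finset (ι × κ)) : ∀ d, B.card + d = N →
    {ω : κ → Ω₀ | ¬ ∃ P, IsPrimeCover D d ((2 * D) ^ N * 2 ^ (N * B.card))
      {p | ∀ j ∈ B, eval p (E j.1 (ω j.2)) = 0} P}.ncard * Nat.card (Fin M → F) ≤
      B.card * (Nat.card (Fin N → F) * Nat.card (κ → Ω₀)) := by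
  classical
  induction B using Finset.induction_on with
  | empty =>
    intro d hd
    rw [Finset.card_empty, zero_add] at hd
    subst hd
    simp only [Finset.card_empty, mul_zero, pow_zero, mul_one, Finset.notMem_empty]
    rw [Set.ncard_eq_zero (Set.toFinite _) |>.2, zero_mul, zero_mul]
    exact Set.eq_empty_of_forall_notMem fun ω hω => hω ⟨_, isPrimeCover_bot hD _⟩
  | insert j B hj ih =>
    intro d hd
    rw [Finset.card_insert_of_notMem hj] at hd ⊢
    let pre : (κ → Ω₀) → B → MvPolynomial (Fin N) F := fun ω j => E j.1.1 (ω j.1.2)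
    let T : (B → MvPolynomial (Fin N) F) → Set (Fin N → F) := fun a => {p | ∀ j, eval p (a j) = 0}
    have hT : ∀ ω, T (pre ω) = {p | ∀ j ∈ B, eval p (E j.1 (ω j.2)) = 0} := fun ω => by
      ext p
      simp only [T, pre, Set.mem_ofPred_eq, Subtype.forall]
    have hstep := ncard_not_cut_mul_le (V := Fin M → F) (D := D) (d := d)
      (C := (2 * D) ^ N * 2 ^ (N * B.card)) pre (fun ω => E j.1 (ω j.2)) (fun ω => hdeg _ _) T ?_
    · simp only [hT] at hstep
      have hsub : {ω : κ → Ω₀ | ¬ ∃ P, IsPrimeCover D d ((2 * D) ^ N * 2 ^ (N * (B.card + 1)))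
            {p | ∀ j' ∈ insert j B, eval p (E j'.1 (ω j'.2)) = 0} P} ⊆
          {ω : κ → Ω₀ | ¬ ∃ P, IsPrimeCover D d ((2 * D) ^ N * 2 ^ (N * B.card) * 2 ^ (d + 1))
            {p | p ∈ {p | ∀ j ∈ B, eval p (E j.1 (ω j.2)) = 0} ∧ eval p (E j.1 (ω j.2)) = 0}
            P} := by
        rintro ω hω ⟨P, hP⟩
        have hset : {p | p ∈ {p | ∀ j ∈ B, eval p (E j.1 (ω j.2)) = 0} ∧
              eval p (E j.1 (ω j.2)) = 0} =
            {p | ∀ j' ∈ insert j B, eval p (E j'.1 (ω j'.2)) = 0} := by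
          ext p
          simp only [Set.mem_ofPred_eq, Finset.forall_mem_insert, and_comm]
        rw [hset] at hP
        refine hω ⟨P, hP.mono ?_⟩
        rw [mul_assoc, ← pow_add, mul_add, mul_one]
        exact Nat.mul_le_mul_left _ (Nat.pow_le_pow_right (by norm_num) (by omega))
      refine (Nat.mul_le_mul_right _ (Set.ncard_le_ncard hsub (Set.toFinite _))).trans
        (hstep.trans ((Nat.add_le_add_right (ih (d + 1) (by omega)) _).trans_eq ?_))
      ring
    · intro a p _ P hP hlt
      obtain ⟨v, hv⟩ := exists_varPoly_injective hlt M
      obtain ⟨w, hw⟩ := hE j.1 v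
      refine ⟨fun c => Pi.single j.2 (w c), fun ω c => ?_, fun η c c' h h' => ?_⟩
      · funext j'
        simp only [pre, Pi.add_apply, map_add, add_eq_left]
        by_cases hk : j'.1.2 = j.2
        · have hi : j'.1.1 ≠ j.1 := fun hi => hj (Prod.ext hi hk ▸ j'.2)
          rw [hk, Pi.single_eq_same, (hw c).2 _ hi]
        · rw [Pi.single_eq_of_ne hk, map_zero]
      · refine (hv c' c ?_).symm
        have h3 := P.sub_mem h h'
        simp only [Pi.sub_apply, Pi.single_eq_same, map_sub, (hw _).1] at h3
        convert h3 using 1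
        ring

end Curves

section Pairs

open MvPolynomial Module

variable {F : Type*} [Field F] {N s : ℕ}

/-- Substitution of a rational point for the left block of variables. -/
noncomputable def substLeft (D : ℕ) (x : Fin N → F) :
    restrictTotalDegree (Fin N ⊕ Fin N) F D →+ MvPolynomial (Fin N) F :=
  substHom D (Sum.elim (fun i => C (x i)) X)

/-- Substitution of a rational point for the right block of variables. -/
noncomputable def substRight (D : ℕ) (y : Fin N → F) :
    restrictTotalDegree (Fin N ⊕ Fin N) F D →+ MvPolynomial (Fin N) F :=
  substHom D (Sum.elim X fun i => C (y i))

theorem totalDegree_substLeft_le (D : ℕ) (x : Fin N → F)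
    (f : restrictTotalDegree (Fin N ⊕ Fin N) F D) : (substLeft D x f).totalDegree ≤ D :=
  totalDegree_substHom_le D (by rintro (i | i) <;> simp) f

theorem totalDegree_substRight_le (D : ℕ) (y : Fin N → F)
    (f : restrictTotalDegree (Fin N ⊕ Fin N) F D) : (substRight D y f).totalDegree ≤ D :=
  totalDegree_substHom_le D (by rintro (i | i) <;> simp) f

theorem eval_substLeft {D : ℕ} (x y : Fin N → F) (f : restrictTotalDegree (Fin N ⊕ Fin N) F D) :
    eval y (substLeft D x f) = eval (Sum.elim x y) f.1 := by
  rw [substLeft, substHom_apply, ← coe_aeval_eq_eval, ← coe_aeval_eq_eval]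
  refine DFunLike.congr_fun (?_ : (aeval y).comp (aeval _) = aeval (R := F) (Sum.elim x y)) f.1
  ext i
  rcases i with i | i <;> simp

theorem eval_substRight {D : ℕ} (x y : Fin N → F) (f : restrictTotalDegree (Fin N ⊕ Fin N) F D) :
    eval x (substRight D y f) = eval (Sum.elim x y) f.1 := by
  rw [substRight, substHom_apply, ← coe_aeval_eq_eval, ← coe_aeval_eq_eval]
  refine DFunLike.congr_fun (?_ : (aeval x).comp (aeval _) = aeval (R := F) (Sum.elim x y)) f.1
  ext i
  rcases i with i | i <;> simp

theorem exists_substLeft_eq_zero_substRight_eq_zero {D M : ℕ} (hD : 2 * s + M ≤ D)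
    (a a' : Fin s → Fin N → F) {p : Fin N ⊕ Fin N → F} (hl : p ∘ Sum.inl ∉ Set.range a)
    (hr : p ∘ Sum.inr ∉ Set.range a') {P : Ideal (MvPolynomial (Fin N ⊕ Fin N) F)} [P.IsPrime]
    (hlt : P < pointIdeal p) :
    ∃ w : (Fin M → F) → restrictTotalDegree (Fin N ⊕ Fin N) F D,
      (∀ i c, substLeft D (a i) (w c) = 0) ∧ (∀ i c, substRight D (a' i) (w c) = 0) ∧
      ∀ c c', (w c).1 - (w c').1 ∈ P → c = c' := by
  classical
  obtain ⟨v, hv⟩ := exists_varPoly_injective hlt M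
  obtain ⟨g, hgd, hg, hg0⟩ := exists_separating_polynomial (Finset.univ.image a)
    (p := p ∘ Sum.inl) (by simpa using hl)
  obtain ⟨h, hhd, hh, hh0⟩ := exists_separating_polynomial (Finset.univ.image a')
    (p := p ∘ Sum.inr) (by simpa using hr)
  replace hgd : g.totalDegree ≤ s := by simpa using hgd.trans Finset.card_image_le
  replace hhd : h.totalDegree ≤ s := by simpa using hhd.trans Finset.card_image_le
  refine ⟨fun c => ⟨rename Sum.inl g * rename Sum.inr h * varPoly v c,
    (mem_restrictTotalDegree _ _ _).2 ?_⟩, fun i c => ?_, fun i c => ?_, fun c c' hc => ?_⟩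
  · have h1 := totalDegree_mul (rename Sum.inl g * rename Sum.inr h) (varPoly v c)
    have h2 := totalDegree_mul (rename (Sum.inl : Fin N → Fin N ⊕ Fin N) g) (rename Sum.inr h)
    have h3 := totalDegree_rename_le (Sum.inl : Fin N → Fin N ⊕ Fin N) g
    have h4 := totalDegree_rename_le (Sum.inr : Fin N → Fin N ⊕ Fin N) h
    have h5 := totalDegree_varPoly_le v c
    omega
  · rw [substLeft, substHom_apply, map_mul, map_mul, aeval_rename]
    have h0 : aeval (fun x => C (a i x)) g = (0 : MvPolynomial (Fin N) F) :=
      (aeval_algebraMap_apply (MvPolynomial (Fin N) F) (a i) g).trans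
        (by rw [aeval_eq_eval, hg0 (a i) (by simp), map_zero])
    rw [Sum.elim_comp_inl, h0, zero_mul, zero_mul]
  · rw [substRight, substHom_apply, map_mul, map_mul, aeval_rename, aeval_rename]
    have h0 : aeval (fun x => C (a' i x)) h = (0 : MvPolynomial (Fin N) F) :=
      (aeval_algebraMap_apply (MvPolynomial (Fin N) F) (a' i) h).trans
        (by rw [aeval_eq_eval, hh0 (a' i) (by simp), map_zero])
    rw [Sum.elim_comp_inr, h0, mul_zero, zero_mul]
  · refine hv c c' ?_
    simp only [← mul_sub] at hc
    refine ((Ideal.IsPrime.mem_or_mem ‹_› hc).resolve_left fun hmem => ?_)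
    have := mem_pointIdeal.1 (hlt.le hmem)
    rw [map_mul, eval_rename, eval_rename] at this
    exact (mul_ne_zero hg hh) this

/-- Pairs of polynomials of degree at most `D` in two blocks of `N` variables. -/
abbrev PolyPair (F : Type*) [Field F] (N D : ℕ) : Type _ :=
  Fin 2 → restrictTotalDegree (Fin N ⊕ Fin N) F D

/-- The pairs of points `(x, y)` off the two given families that satisfy all the equations
`ω k (x, y) = ω k (a i, y) = ω k (x, a' i) = 0`. -/
def incidentPairs {D : ℕ} (ω : PolyPair F N D)
    (a a' : Fin s → Fin N → F) : Set (Fin N ⊕ Fin N → F) :=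
  {p | (p ∘ Sum.inl ∉ Set.range a ∧ p ∘ Sum.inr ∉ Set.range a' ∧
      (∀ i k, eval (p ∘ Sum.inr) (substLeft D (a i) (ω k)) = 0) ∧
      ∀ i k, eval (p ∘ Sum.inl) (substRight D (a' i) (ω k)) = 0) ∧ ∀ k, eval p (ω k).1 = 0}

/-- The bound on the number of incident pairs. -/
def pairBound (N s D : ℕ) : ℕ := ((2 * D) ^ N * 2 ^ (N * (s * 2))) ^ 2 * 2 ^ 2 * 2

theorem ncard_incidentPairs_not_le_mul_le [Finite F] {D M : ℕ} (hN : N = 2 * s + 1)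
    (hD : 2 * s + M ≤ D) (hD1 : 1 ≤ D) {a a' : Fin s → Fin N → F} (ha : Function.Injective a)
    (ha' : Function.Injective a') :
    {ω : PolyPair F N D |
      ¬ (incidentPairs ω a a').ncard ≤ pairBound N s D}.ncard * Nat.card F ^ M ≤
      (4 * s + 2) * Nat.card F ^ (2 * N) *
        Nat.card (PolyPair F N D) := by
  classical
  have hfin : Finite (restrictTotalDegree (Fin N ⊕ Fin N) F D) := Module.finite_of_finite F
  set K := (2 * D) ^ N * 2 ^ (N * (s * 2)) with hK
  have hcard : (Finset.univ : Finset (Fin s × Fin 2)).card = s * 2 := by simp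
  have hL := ncard_not_isPrimeCover_mul_le (M := M) (κ := Fin 2) hD1
    (fun i => substLeft D (a i)) (fun i => totalDegree_substLeft_le D (a i))
    (exists_substHom_eq_varPoly (by rw [Fintype.card_fin]; omega) _ ha Sum.inl Sum.inr
      (fun _ _ => rfl) fun _ _ => rfl) Finset.univ 1 (by omega)
  have hR := ncard_not_isPrimeCover_mul_le (M := M) (κ := Fin 2) hD1
    (fun i => substRight D (a' i)) (fun i => totalDegree_substRight_le D (a' i))
    (exists_substHom_eq_varPoly (by rw [Fintype.card_fin]; omega) _ ha' Sum.inr Sum.inl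
      (fun _ _ => rfl) fun _ _ => rfl) Finset.univ 1 (by omega)
  rw [hcard, ← hK] at hL hR
  let A := (Fin s → Fin 2 → MvPolynomial (Fin N) F) × (Fin s → Fin 2 → MvPolynomial (Fin N) F)
  let pre : PolyPair F N D → A := fun ω =>
    (fun i k => substLeft D (a i) (ω k), fun i k => substRight D (a' i) (ω k))
  let T : A → Set (Fin N ⊕ Fin N → F) := fun x => {p | p ∘ Sum.inl ∉ Set.range a ∧
    p ∘ Sum.inr ∉ Set.range a' ∧ (∀ i k, eval (p ∘ Sum.inr) (x.1 i k) = 0) ∧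
      ∀ i k, eval (p ∘ Sum.inl) (x.2 i k) = 0}
  let T' : A × MvPolynomial (Fin N ⊕ Fin N) F → Set (Fin N ⊕ Fin N → F) := fun x =>
    {p | p ∈ T x.1 ∧ eval p x.2 = 0}
  have hdeg : ∀ (ω : PolyPair F N D) k, (ω k).1.totalDegree ≤ D := fun ω k =>
    (mem_restrictTotalDegree _ _ _).1 (ω k).2
  have hfirst := ncard_not_cut_mul_le (V := Fin M → F) (D := D) (d := 1) (C := K ^ 2) pre
    (fun ω => (ω 0).1) (fun ω => hdeg ω 0) T fun x p hp P hP hlt => by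
      obtain ⟨w, hw1, hw2, hw3⟩ :=
        exists_substLeft_eq_zero_substRight_eq_zero hD a a' hp.1 hp.2.1 hlt
      refine ⟨fun c => Pi.single 0 (w c), fun ω c => ?_, fun η c c' h h' => ?_⟩
      · refine Prod.ext ?_ ?_ <;> funext i k <;>
          simp only [pre, Pi.add_apply, map_add, add_eq_left] <;> by_cases hk : k = 0
        · rw [hk, Pi.single_eq_same, hw1]
        · rw [Pi.single_eq_of_ne hk, map_zero]
        · rw [hk, Pi.single_eq_same, hw2]
        · rw [Pi.single_eq_of_ne hk, map_zero]
      · refine (hw3 c' c ?_).symm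
        have h3 := P.sub_mem h h'
        simpa only [Pi.sub_apply, Pi.single_eq_same, Submodule.coe_sub,
          sub_sub_sub_cancel_left] using h3
  have hsecond := ncard_not_cut_mul_le (V := Fin M → F) (D := D) (d := 0) (C := K ^ 2 * 2 ^ 2)
    (fun ω => (pre ω, (ω 0).1)) (fun ω => (ω 1).1) (fun ω => hdeg ω 1) T' fun x p hp P hP hlt => by
      obtain ⟨w, hw1, hw2, hw3⟩ :=
        exists_substLeft_eq_zero_substRight_eq_zero hD a a' hp.1.1 hp.1.2.1 hlt
      refine ⟨fun c => Pi.single 1 (w c), fun ω c => ?_, fun η c c' h h' => ?_⟩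
      · refine Prod.ext (Prod.ext ?_ ?_) (by simp)
        all_goals
          funext i k
          simp only [pre, Pi.add_apply, map_add, add_eq_left]
          by_cases hk : k = 1
        · rw [hk, Pi.single_eq_same, hw1]
        · rw [Pi.single_eq_of_ne hk, map_zero]
        · rw [hk, Pi.single_eq_same, hw2]
        · rw [Pi.single_eq_of_ne hk, map_zero]
      · refine (hw3 c' c ?_).symm
        have h3 := P.sub_mem h h'
        simpa only [Pi.sub_apply, Pi.single_eq_same, Submodule.coe_sub,
          sub_sub_sub_cancel_left] using h3
  have hpair : {ω : PolyPair F N D | ¬ ∃ P, IsPrimeCover D 2 (K ^ 2) (T (pre ω)) P} ⊆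
      {ω : PolyPair F N D | ¬ ∃ P, IsPrimeCover D 1 K
        {p | ∀ j ∈ (Finset.univ : Finset (Fin s × Fin 2)),
          eval p (substLeft D (a j.1) (ω j.2)) = 0} P} ∪
      {ω : PolyPair F N D | ¬ ∃ P, IsPrimeCover D 1 K
        {p | ∀ j ∈ (Finset.univ : Finset (Fin s × Fin 2)),
          eval p (substRight D (a' j.1) (ω j.2)) = 0} P} := by
    intro ω hω
    rw [Set.mem_union]
    by_contra hcon
    rw [not_or] at hcon
    obtain ⟨P₁, h₁⟩ := not_not.1 hcon.1
    obtain ⟨P₂, h₂⟩ := not_not.1 hcon.2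
    rw [pow_two] at hω
    exact hω (h₂.sum h₁ fun p hp => ⟨fun j _ => hp.2.2.2 j.1 j.2, fun j _ => hp.2.2.1 j.1 j.2⟩)
  have hlast : {ω : PolyPair F N D | ¬ (incidentPairs ω a a').ncard ≤ pairBound N s D} ⊆
      {ω : PolyPair F N D | ¬ ∃ P, IsPrimeCover D 0 (K ^ 2 * 2 ^ 2 * 2 ^ (0 + 1))
        {p | p ∈ T' (pre ω, (ω 0).1) ∧ eval p (ω 1).1 = 0} P} := by
    rintro ω hω ⟨P, hP⟩
    refine hω ?_
    have hset : {p | p ∈ T' (pre ω, (ω 0).1) ∧ eval p (ω 1).1 = 0} =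
        ((incidentPairs ω a a').toFinite.toFinset : Set (Fin N ⊕ Fin N → F)) := by
      ext p
      rw [Set.Finite.coe_toFinset]
      simp only [T', T, pre, incidentPairs, Set.mem_ofPred_eq, Fin.forall_fin_two (p := fun k =>
        eval p (ω k).1 = 0), and_assoc]
    rw [hset] at hP
    rw [Set.ncard_eq_toFinset_card _ (Set.toFinite _)]
    exact hP.card_le hD1
  have h1 := Nat.mul_le_mul_right (Nat.card (Fin M → F))
    (Set.ncard_le_ncard hlast (Set.toFinite _))
  have h2 := Nat.mul_le_mul_right (Nat.card (Fin M → F))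
    ((Set.ncard_le_ncard hpair (Set.toFinite _)).trans (Set.ncard_union_le _ _))
  rw [add_mul] at h2
  have hVc : Nat.card (Fin M → F) = Nat.card F ^ M := by simp [Nat.card_fun]
  have hNc : Nat.card (Fin N → F) = Nat.card F ^ N := by simp [Nat.card_fun]
  have hNNc : Nat.card (Fin N ⊕ Fin N → F) = Nat.card F ^ (2 * N) := by
    simp [Nat.card_fun, two_mul]
  have hpow : Nat.card F ^ N ≤ Nat.card F ^ (2 * N) :=
    Nat.pow_le_pow_right Nat.card_pos (by omega)
  have hpow' := Nat.mul_le_mul_left (s * 2) (Nat.mul_le_mul_right (Nat.card (PolyPair F N D)) hpow)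
  rw [hNNc] at hfirst hsecond
  rw [hNc] at hL hR
  rw [← hVc]
  have h3 : (4 * s + 2) * Nat.card F ^ (2 * N) * Nat.card (PolyPair F N D) =
      s * 2 * (Nat.card F ^ (2 * N) * Nat.card (PolyPair F N D)) +
      s * 2 * (Nat.card F ^ (2 * N) * Nat.card (PolyPair F N D)) +
      Nat.card F ^ (2 * N) * Nat.card (PolyPair F N D) +
      Nat.card F ^ (2 * N) * Nat.card (PolyPair F N D) := by ring
  rw [h3]
  refine h1.trans (hsecond.trans (Nat.add_le_add_right (hfirst.trans (Nat.add_le_add_right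
    (h2.trans (add_le_add (hL.trans hpow') (hR.trans hpow'))) _)) _))

end Pairs

section Averaging

open MvPolynomial Module

variable {F : Type*} [Field F] {N s : ℕ}

/-- The pair of constant polynomials with the given values. -/
noncomputable def constPair (N D : ℕ) (c : Fin 2 → F) : PolyPair F N D :=
  fun k => ⟨C (c k), (mem_restrictTotalDegree _ _ _).2 (by simp)⟩

theorem ncard_bad_mul_lt [Finite F] {D M : ℕ} (hN : N = 2 * s + 1)
    (hM : M = 2 * N + 2 * s * N + 3) (hD : 2 * s + M ≤ D) (hq : 4 * s + 2 < Nat.card F) :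
    {ω : PolyPair F N D | ∃ a a' : Fin s → Fin N → F, Function.Injective a ∧
      Function.Injective a' ∧ ¬ (incidentPairs ω a a').ncard ≤ pairBound N s D}.ncard *
      Nat.card F ^ 2 < Nat.card (PolyPair F N D) := by
  classical
  have hfin : Finite (restrictTotalDegree (Fin N ⊕ Fin N) F D) := Module.finite_of_finite F
  have := Fintype.ofFinite F
  set q := Nat.card F with hq'
  have hq0 : 0 < q := by omega
  let B : (Fin s → Fin N → F) × (Fin s → Fin N → F) → Set (PolyPair F N D) := fun x =>
    {ω | Function.Injective x.1 ∧ Function.Injective x.2 ∧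
      ¬ (incidentPairs ω x.1 x.2).ncard ≤ pairBound N s D}
  set bad := {ω : PolyPair F N D | ∃ a a' : Fin s → Fin N → F, Function.Injective a ∧
      Function.Injective a' ∧ ¬ (incidentPairs ω a a').ncard ≤ pairBound N s D} with hbad
  have hB : ∀ x, (B x).ncard * q ^ M ≤
      (4 * s + 2) * q ^ (2 * N) * Nat.card (PolyPair F N D) := by
    intro x
    by_cases hx : Function.Injective x.1 ∧ Function.Injective x.2
    · refine le_trans (Nat.mul_le_mul_right _ (Set.ncard_le_ncard (fun ω hω => hω.2.2)
        (Set.toFinite _))) (ncard_incidentPairs_not_le_mul_le hN hD (by omega) hx.1 hx.2)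
    · rw [Set.eq_empty_of_forall_notMem (s := B x) fun ω hω => hx ⟨hω.1, hω.2.1⟩]
      simp
  have hsub : bad ⊆ ⋃ x, B x := by
    rintro ω ⟨a, a', h⟩
    exact Set.mem_iUnion.2 ⟨(a, a'), h⟩
  have hcard : Fintype.card ((Fin s → Fin N → F) × (Fin s → Fin N → F)) = q ^ (2 * s * N) := by
    rw [← Nat.card_eq_fintype_card, Nat.card_prod, Nat.card_fun, Nat.card_fun, Nat.card_fin,
      Nat.card_fin, ← pow_mul, ← pow_add]
    congr 1
    ring
  have h1 : bad.ncard * q ^ M ≤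
      q ^ (2 * s * N) * ((4 * s + 2) * q ^ (2 * N) * Nat.card (PolyPair F N D)) :=
    calc bad.ncard * q ^ M ≤ (∑ x, (B x).ncard) * q ^ M := Nat.mul_le_mul_right _
          ((Set.ncard_le_ncard hsub (Set.toFinite _)).trans (Set.ncard_iUnion_le_of_fintype _))
      _ = ∑ x, (B x).ncard * q ^ M := Finset.sum_mul _ _ _
      _ ≤ ∑ _x : (Fin s → Fin N → F) × (Fin s → Fin N → F),
          (4 * s + 2) * q ^ (2 * N) * Nat.card (PolyPair F N D) :=
        Finset.sum_le_sum fun x _ => hB x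
      _ = _ := by rw [Finset.sum_const, Finset.card_univ, hcard, smul_eq_mul]
  have h2 : (bad.ncard * q ^ 2 * q) * q ^ (2 * N + 2 * s * N) ≤
      ((4 * s + 2) * Nat.card (PolyPair F N D)) * q ^ (2 * N + 2 * s * N) := by
    calc _ = bad.ncard * q ^ M := by rw [hM]; ring
      _ ≤ _ := h1
      _ = _ := by ring
  have h3 := Nat.le_of_mul_le_mul_right h2 (pow_pos hq0 _)
  have hpos : 0 < Nat.card (PolyPair F N D) := Nat.card_pos
  refine Nat.lt_of_mul_lt_mul_right (a := q) (h3.trans_lt ?_)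
  rw [mul_comm]
  exact Nat.mul_lt_mul_of_pos_left hq hpos

theorem exists_polyPair [Finite F] {D M : ℕ} (hN : N = 2 * s + 1)
    (hM : M = 2 * N + 2 * s * N + 3) (hD : 2 * s + M ≤ D) (hq : 4 * s + 2 < Nat.card F) :
    ∃ ω : PolyPair F N D, Nat.card F ^ (4 * s) ≤
        {p : Fin N ⊕ Fin N → F | ∀ k, eval p (ω k).1 = 0}.ncard ∧
      ∀ a a' : Fin s → Fin N → F, Function.Injective a → Function.Injective a' →
        (incidentPairs ω a a').ncard ≤ pairBound N s D := by
  classical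
  have hfin : Finite (restrictTotalDegree (Fin N ⊕ Fin N) F D) := Module.finite_of_finite F
  have := Fintype.ofFinite F
  have hlt := ncard_bad_mul_lt hN hM hD hq
  set bad := {ω : PolyPair F N D | ∃ a a' : Fin s → Fin N → F, Function.Injective a ∧
      Function.Injective a' ∧ ¬ (incidentPairs ω a a').ncard ≤ pairBound N s D} with hbad
  have hcard : Fintype.card (Fin 2 → F) = Nat.card F ^ 2 := by simp
  obtain ⟨ω, hω⟩ : ∃ ω : PolyPair F N D, ∀ c : Fin 2 → F, ω + constPair N D c ∉ bad := by
    by_contra! hcon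
    have h1 : (Set.univ : Set (PolyPair F N D)) ⊆
        ⋃ c : Fin 2 → F, {ω | ω + constPair N D c ∈ bad} :=
      fun ω _ => Set.mem_iUnion.2 (hcon ω)
    have h2 : ∀ c : Fin 2 → F, {ω | ω + constPair N D c ∈ bad}.ncard ≤ bad.ncard := fun c =>
      Set.ncard_le_ncard_of_injOn (· + constPair N D c) (fun ω hω => hω)
        (add_left_injective _).injOn (Set.toFinite _)
    have h3 := (Set.ncard_le_ncard h1 (Set.toFinite _)).trans
      ((Set.ncard_iUnion_le_of_fintype _).trans (Finset.sum_le_sum fun c _ => h2 c))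
    rw [Set.ncard_univ, Finset.sum_const, Finset.card_univ, hcard, smul_eq_mul, mul_comm] at h3
    omega
  let Z : (Fin 2 → F) → Set (Fin N ⊕ Fin N → F) := fun c =>
    {p | ∀ k, eval p ((ω + constPair N D c) k).1 = 0}
  obtain ⟨c, hc⟩ : ∃ c, Nat.card F ^ (4 * s) ≤ (Z c).ncard := by
    by_contra! hcon
    have h1 : (Set.univ : Set (Fin N ⊕ Fin N → F)) ⊆ ⋃ c, Z c := fun p _ =>
      Set.mem_iUnion.2 ⟨fun k => - eval p (ω k).1, fun k => by simp [constPair]⟩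
    have h2 := (Set.ncard_le_ncard h1 (Set.toFinite _)).trans (Set.ncard_iUnion_le_of_fintype _)
    have h3 : ∑ c, (Z c).ncard < ∑ _c : Fin 2 → F, Nat.card F ^ (4 * s) :=
      Finset.sum_lt_sum_of_nonempty Finset.univ_nonempty fun c _ => hcon c
    rw [Finset.sum_const, Finset.card_univ, hcard, smul_eq_mul, ← pow_add] at h3
    rw [Set.ncard_univ, Nat.card_fun, Nat.card_sum, Nat.card_fin,
      show N + N = 2 + 4 * s by omega] at h2
    omega
  refine ⟨ω + constPair N D c, hc, fun a a' ha ha' => ?_⟩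
  by_contra hcon
  exact hω c ⟨a, a', ha, ha', hcon⟩

/-- The bound on the number of common pairs, as a function of `s` only. -/
def linkBound (s : ℕ) : ℕ :=
  pairBound (2 * s + 1) s (2 * s + (2 * (2 * s + 1) + 2 * s * (2 * s + 1) + 3))

theorem exists_relation [Finite F] (s : ℕ) (hq : 4 * s + 2 < Nat.card F) :
    ∃ r : (Fin (2 * s + 1) → F) → (Fin (2 * s + 1) → F) → Prop,
      Nat.card F ^ (4 * s) ≤ {p : (Fin (2 * s + 1) → F) × (Fin (2 * s + 1) → F) |
        r p.1 p.2}.ncard ∧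
      ∀ a a' : Fin s → Fin (2 * s + 1) → F, Function.Injective a → Function.Injective a' →
        {p : (Fin (2 * s + 1) → F) × (Fin (2 * s + 1) → F) | p.1 ∉ Set.range a ∧
          p.2 ∉ Set.range a' ∧ (∀ i, r (a i) p.2) ∧ (∀ i, r p.1 (a' i)) ∧ r p.1 p.2}.ncard ≤
          linkBound s := by
  obtain ⟨ω, hω, hω'⟩ := exists_polyPair (F := F) (s := s) rfl rfl le_rfl hq
  refine ⟨fun x y => ∀ k, eval (Sum.elim x y) (ω k).1 = 0, hω.trans ?_, fun a a' ha ha' =>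
    le_trans ?_ (hω' a a' ha ha')⟩
  · refine Set.ncard_le_ncard_of_injOn (fun p => (p ∘ Sum.inl, p ∘ Sum.inr)) (fun p hp k => ?_)
      (fun p _ p' _ h => ?_) (Set.toFinite _)
    · simpa only [Sum.elim_comp_inl_inr] using hp k
    · rw [Prod.mk.injEq] at h
      rw [← Sum.elim_comp_inl_inr p, h.1, h.2, Sum.elim_comp_inl_inr]
  · refine Set.ncard_le_ncard_of_injOn (fun p => Sum.elim p.1 p.2) (fun p hp => ?_)
      (fun p _ p' _ h => ?_) (Set.toFinite _)
    · obtain ⟨h1, h2, h3, h4, h5⟩ := hp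
      refine ⟨⟨h1, h2, fun i k => ?_, fun i k => ?_⟩, h5⟩
      · rw [eval_substLeft]
        exact h3 i k
      · rw [eval_substRight]
        exact h4 i k
    · exact Prod.ext (by simpa using congrArg (· ∘ Sum.inl) h)
        (by simpa using congrArg (· ∘ Sum.inr) h)

end Averaging

section BipartiteGraph

variable {V W : Type*}

/-- The bipartite graph of a relation on `V`, placed on `W` by an embedding of `V ⊕ V`. -/
def relGraph (r : V → V → Prop) (e : V ⊕ V ↪ W) : SimpleGraph W where
  Adj u v := ∃ x y, r x y ∧
    (u = e (.inl x) ∧ v = e (.inr y) ∨ v = e (.inl x) ∧ u = e (.inr y))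
  symm := ⟨fun _ _ ⟨x, y, h, h'⟩ => ⟨x, y, h, h'.symm⟩⟩
  loopless := ⟨by
    rintro u ⟨x, y, -, ⟨h, h'⟩ | ⟨h, h'⟩⟩ <;> simpa using e.injective (h.symm.trans h')⟩

variable {r : V → V → Prop} {e : V ⊕ V ↪ W}

theorem relGraph_adj_inl {x : V} {v : W} (h : (relGraph r e).Adj (e (.inl x)) v) :
    ∃ y, v = e (.inr y) ∧ r x y := by
  obtain ⟨x', y, hr, ⟨h, h'⟩ | ⟨-, h⟩⟩ := h
  · obtain rfl : x = x' := by simpa using e.injective h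
    exact ⟨y, h', hr⟩
  · simpa using e.injective h

theorem relGraph_adj_inr {y : V} {v : W} (h : (relGraph r e).Adj (e (.inr y)) v) :
    ∃ x, v = e (.inl x) ∧ r x y := by
  obtain ⟨x, y', hr, ⟨h, -⟩ | ⟨h', h⟩⟩ := h
  · simpa using e.injective h
  · obtain rfl : y = y' := by simpa using e.injective h
    exact ⟨x, h', hr⟩

theorem ncard_le_ncard_edgeSet_relGraph [Finite W] :
    {p : V × V | r p.1 p.2}.ncard ≤ (relGraph r e).edgeSet.ncard := by
  refine Set.ncard_le_ncard_of_injOn (fun p => s(e (.inl p.1), e (.inr p.2))) ?_ ?_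
    (Set.toFinite _)
  · intro p hp
    exact ⟨p.1, p.2, hp, .inl ⟨rfl, rfl⟩⟩
  · intro p _ p' _ h
    simpa [Prod.ext_iff] using h

theorem Hgraph_adj_side {s t : ℕ} (i : Fin s) (j : Fin t) (b : Bool) :
    (Hgraph s t).Adj (.inl i, b) (.inr j, b) := by
  simp [Hgraph]

theorem Hgraph_adj_matching {s t : ℕ} (v : Fin s ⊕ Fin t) (b : Bool) :
    (Hgraph s t).Adj (v, b) (v, !b) := by
  simp [Hgraph]

/-- A copy of `H_{s,t}` in the graph of a relation yields two sets of `s` vertices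
whose common link contains `t` edges. -/
theorem not_contains_relGraph [Finite V] {s t B : ℕ} (hs : 0 < s) (ht : B < t)
    (hr : ∀ a a' : Fin s → V, Function.Injective a → Function.Injective a' →
      {p : V × V | p.1 ∉ Set.range a ∧ p.2 ∉ Set.range a' ∧ (∀ i, r (a i) p.2) ∧
        (∀ i, r p.1 (a' i)) ∧ r p.1 p.2}.ncard ≤ B) :
    ¬ (relGraph r e).Contains (Hgraph s t) := by
  rintro ⟨f, hf⟩
  let j₀ : Fin t := ⟨0, by omega⟩
  let i₀ : Fin s := ⟨0, hs⟩
  obtain ⟨b, x₀, hx₀⟩ : ∃ b x, f (.inl i₀, b) = e (.inl x) := by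
    obtain ⟨x, y, -, ⟨h, -⟩ | ⟨-, h⟩⟩ := f.map_adj (Hgraph_adj_side i₀ j₀ false)
    · exact ⟨false, x, h⟩
    · have h' := f.map_adj (Hgraph_adj_matching (.inl i₀ : Fin s ⊕ Fin t) false)
      rw [h] at h'
      obtain ⟨x, hx, -⟩ := relGraph_adj_inr h'
      exact ⟨true, x, hx⟩
  have hy : ∀ j, ∃ y, f (.inr j, b) = e (.inr y) := fun j => by
    have h := f.map_adj (Hgraph_adj_side i₀ j b)
    rw [hx₀] at h
    obtain ⟨y, hy, -⟩ := relGraph_adj_inl h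
    exact ⟨y, hy⟩
  choose y hy using hy
  have ha : ∀ i, ∃ x, f (.inl i, b) = e (.inl x) := fun i => by
    have h := (f.map_adj (Hgraph_adj_side i j₀ b)).symm
    rw [hy] at h
    obtain ⟨x, hx, -⟩ := relGraph_adj_inr h
    exact ⟨x, hx⟩
  choose a ha using ha
  have ha' : ∀ i, ∃ x, f (.inl i, !b) = e (.inr x) := fun i => by
    have h := f.map_adj (Hgraph_adj_matching (.inl i : Fin s ⊕ Fin t) b)
    rw [ha] at h
    obtain ⟨x, hx, -⟩ := relGraph_adj_inl h
    exact ⟨x, hx⟩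
  choose a' ha' using ha'
  have hz : ∀ j, ∃ z, f (.inr j, !b) = e (.inl z) ∧ r z (y j) := fun j => by
    have h := f.map_adj (Hgraph_adj_matching (.inr j : Fin s ⊕ Fin t) b)
    rw [hy] at h
    exact relGraph_adj_inr h
  choose z hz hzy using hz
  have hay : ∀ i j, r (a i) (y j) := fun i j => by
    have h := f.map_adj (Hgraph_adj_side i j b)
    rw [ha] at h
    obtain ⟨y', hy', h'⟩ := relGraph_adj_inl h
    rw [hy] at hy'
    obtain rfl : y j = y' := by simpa using e.injective hy'
    exact h'
  have hza : ∀ i j, r (z j) (a' i) := fun i j => by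
    have h := f.map_adj (Hgraph_adj_side i j (!b))
    rw [ha'] at h
    obtain ⟨z', hz', h'⟩ := relGraph_adj_inr h
    rw [hz] at hz'
    obtain rfl : z j = z' := by simpa using e.injective hz'
    exact h'
  have key := hr a a'
    (fun i i' h => by
      simpa using hf ((ha i).trans ((congrArg _ (congrArg _ h)).trans (ha i').symm)))
    (fun i i' h => by
      simpa using hf ((ha' i).trans ((congrArg _ (congrArg _ h)).trans (ha' i').symm)))
  have hsub : Set.range (fun j => (z j, y j)) ⊆ {p : V × V | p.1 ∉ Set.range a ∧
      p.2 ∉ Set.range a' ∧ (∀ i, r (a i) p.2) ∧ (∀ i, r p.1 (a' i)) ∧ r p.1 p.2} := by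
    rintro _ ⟨j, rfl⟩
    refine ⟨?_, ?_, fun i => hay i j, fun i => hza i j, hzy j⟩
    · rintro ⟨i, hi⟩
      simpa using hf ((ha i).trans ((congrArg _ (congrArg _ hi)).trans (hz j).symm))
    · rintro ⟨i, hi⟩
      simpa using hf ((ha' i).trans ((congrArg _ (congrArg _ hi)).trans (hy j).symm))
  have hinj : Function.Injective fun j => (z j, y j) := fun j j' h => by
    simpa using hf ((hy j).trans ((congrArg _ (congrArg _ (congrArg Prod.snd h))).trans
      (hy j').symm))
  have h1 := Set.ncard_le_ncard hsub (Set.toFinite _)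
  rw [← Set.image_univ, Set.ncard_image_of_injective _ hinj, Set.ncard_univ, Nat.card_fin] at h1
  omega

theorem ncard_edgeSet_le_exNum {β : Type*} {n : ℕ} {H : SimpleGraph β}
    (G : SimpleGraph (Fin n)) (hG : ¬ G.Contains H) : G.edgeSet.ncard ≤ exNum n H := by
  refine le_csSup ⟨Nat.card (Sym2 (Fin n)), ?_⟩ ⟨G, hG, rfl⟩
  rintro _ ⟨G', -, rfl⟩
  exact Set.ncard_le_card _

theorem pow_le_exNum {s t n q : ℕ} (hq : q.Prime) (hs : 0 < s) (ht : linkBound s < t)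
    (hsq : 4 * s + 2 < q) (hn : 2 * q ^ (2 * s + 1) ≤ n) :
    q ^ (4 * s) ≤ exNum n (Hgraph s t) := by
  have : Fact q.Prime := ⟨hq⟩
  obtain ⟨r, hcard, hr⟩ := exists_relation (F := ZMod q) s (by simpa using hsq)
  have hV : Fintype.card ((Fin (2 * s + 1) → ZMod q) ⊕ (Fin (2 * s + 1) → ZMod q)) ≤
      Fintype.card (Fin n) := by
    simpa [ZMod.card, ← two_mul] using hn
  obtain ⟨e⟩ := Function.Embedding.nonempty_of_card_le hV
  rw [Nat.card_zmod] at hcard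
  exact (hcard.trans ncard_le_ncard_edgeSet_relGraph).trans
    (ncard_edgeSet_le_exNum (relGraph r e) (not_contains_relGraph hs ht hr))

/-- For a large integer `n`, some prime `q` satisfies `2 q ^ d ≤ n ≤ 2 * 4 ^ d * q ^ d`. -/
theorem exists_prime_pow_near {d m n : ℕ} (hd : d ≠ 0) (hm : m ≠ 0)
    (hn : 2 * (2 * m) ^ d ≤ n) :
    ∃ q : ℕ, q.Prime ∧ m < q ∧ 2 * q ^ d ≤ n ∧ n ≤ 2 * 4 ^ d * q ^ d := by
  let P : ℕ → Prop := fun k => 2 * (2 * k) ^ d ≤ n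
  have hbound : ∀ k, P k → k ≤ n := fun k hk => by
    have := Nat.le_self_pow hd (2 * k)
    have : 2 * (2 * k) ^ d ≤ n := hk
    omega
  classical
  let k := Nat.findGreatest P n
  have hk : P k := Nat.findGreatest_spec (hbound m hn) hn
  have hmk : m ≤ k := Nat.le_findGreatest (hbound m hn) hn
  have hk' : ¬ P (k + 1) := fun h =>
    absurd (Nat.le_findGreatest (hbound _ h) h) (by simp [k])
  obtain ⟨q, hq, hkq, hqk⟩ := Nat.exists_prime_lt_and_le_two_mul k (by omega)
  refine ⟨q, hq, by omega, le_trans ?_ hk, ?_⟩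
  · gcongr
  · calc n ≤ 2 * (2 * (k + 1)) ^ d := (not_le.mp hk').le
      _ ≤ 2 * (4 * q) ^ d := by gcongr 2 * ?_ ^ d; omega
      _ = _ := by rw [mul_pow, mul_assoc]

end BipartiteGraph

/-- There is $ℓ : ℕ → ℕ$ such that for all $s ≥ 2$ and $t ≥ ℓ(s)$ there is $c > 0$ with
$ex(n, H_{s,t}) ≥ c · n^{2 - 2/(2s+1)}$ for all sufficiently large $n$. -/
theorem ex_Hst_lower :
    ∃ ℓ : ℕ → ℕ, ∀ s t : ℕ, 2 ≤ s → ℓ s ≤ t →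
      ∃ c : ℝ, 0 < c ∧
        ∀ᶠ n : ℕ in atTop,
          c * (n : ℝ) ^ ((2 : ℝ) - 2 / (2 * s + 1)) ≤ (exNum n (Hgraph s t) : ℝ) := by
  refine ⟨fun s => linkBound s + 1, fun s t hs ht => ?_⟩
  set d : ℕ := 2 * s + 1 with hd
  set K : ℝ := 2 * 4 ^ d with hK
  set α : ℝ := (2 : ℝ) - 2 / (2 * s + 1) with hα
  have hd0 : (0 : ℝ) < 2 * s + 1 := by positivity
  have hdα : (d : ℝ) * α = (4 * s : ℕ) := by
    rw [hα, hd]; push_cast; field_simp; ring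
  have hα0 : 0 ≤ α := by
    have : (0 : ℝ) < d := by positivity
    refine nonneg_of_mul_nonneg_right ?_ this
    rw [hdα]; positivity
  have hK0 : 0 < K := by positivity
  refine ⟨(K ^ α)⁻¹, by positivity, ?_⟩
  filter_upwards [eventually_ge_atTop (2 * (2 * (4 * s + 2)) ^ d)] with n hn
  obtain ⟨q, hq, hsq, hqn, hnq⟩ := exists_prime_pow_near (by omega) (by omega) hn
  have hmain : (q : ℝ) ^ (4 * s) ≤ exNum n (Hgraph s t) := by
    exact_mod_cast pow_le_exNum hq (by omega) ht hsq hqn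
  refine le_trans ?_ hmain
  rw [inv_mul_le_iff₀ (by positivity)]
  calc (n : ℝ) ^ α ≤ (K * (q : ℝ) ^ d) ^ α := by
        gcongr
        rw [hK]
        exact_mod_cast hnq
    _ = K ^ α * (q : ℝ) ^ (4 * s) := by
        rw [Real.mul_rpow (by positivity) (by positivity), ← Real.rpow_natCast _ d,
          ← Real.rpow_mul (by positivity), hdα, Real.rpow_natCast]
end
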